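/- Let Ω be a finite set and let G be a solvable subgroup of the symmetric group on Ω acting primitively on Ω. Let G₀ be the set of elements of G of odd prime order, and let 𝒮 be the set of ordered pairs (g, Γ) with g ∈ G₀, Γ ⊆ Ω, and g(Γ) = Γ. Then |𝒮| ≤ 24^(−1/3) · 2^(5|Ω|/9) · |Ω|^(13/4) (an inequality of real numbers). -/

import Mathlib

open Pointwise

/-- A permutation group `(G, Ω)` is primitive if it is transitive and every block is trivial. -/
def IsPrimitivePermGroup (Ω : Type*) [Fintype Ω] (G : Subgroup (Equiv.Perm Ω)) : Prop :=
  MulAction.IsPretransitive G Ω ∧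
    ∀ B : Set Ω, MulAction.IsBlock G B → MulAction.IsTrivialBlock B

theorem exists_normal_elementary_abelian (G : Type*) [Group G] [Finite G] [Nontrivial G]
    (hG : Group.IsSolvable G) :
    ∃ (r : ℕ) (A : Subgroup G), r.Prime ∧ A.Normal ∧ A ≠ ⊥ ∧
      (∀ a ∈ A, ∀ b ∈ A, a * b = b * a) ∧ ∀ a ∈ A, a ^ r = 1 := by
  classical
  have hex : ∃ n, derivedSeries G n = ⊥ := hG.solvable
  obtain ⟨m, hm⟩ : ∃ m, Nat.find hex = m + 1 := by
    refine Nat.exists_eq_succ_of_ne_zero fun h0 => ?_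
    have := Nat.find_spec hex
    rw [h0, derivedSeries_zero] at this
    exact top_ne_bot this
  have hbot : derivedSeries G (m + 1) = ⊥ := hm ▸ Nat.find_spec hex
  have hne : derivedSeries G m ≠ ⊥ := Nat.find_min hex (by omega)
  set B := derivedSeries G m with hB
  have hBn : B.Normal := derivedSeries_normal G m
  have hcomm : ∀ a ∈ B, ∀ b ∈ B, a * b = b * a := by
    intro a ha b hb
    rw [derivedSeries_succ, Subgroup.commutator_eq_bot_iff_le_centralizer] at hbot
    exact ((Subgroup.mem_centralizer_iff.1 (hbot ha)) b hb).symm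
  have hcard : Nat.card B ≠ 1 := fun h => hne (Subgroup.card_eq_one.1 h)
  obtain ⟨r, hr, hrd⟩ := Nat.exists_prime_and_dvd hcard
  have := Fact.mk hr
  obtain ⟨x, hx⟩ := exists_prime_orderOf_dvd_card' r hrd
  let A : Subgroup G :=
    { carrier := {a | a ∈ B ∧ a ^ r = 1}
      one_mem' := ⟨B.one_mem, one_pow r⟩
      mul_mem' := by
        rintro a b ⟨ha, ha'⟩ ⟨hb, hb'⟩
        refine ⟨B.mul_mem ha hb, ?_⟩
        rw [(show Commute a b from hcomm a ha b hb).mul_pow, ha', hb', one_mul]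
      inv_mem' := by
        rintro a ⟨ha, ha'⟩
        exact ⟨B.inv_mem ha, by rw [inv_pow, ha', inv_one]⟩ }
  refine ⟨r, A, hr, ⟨?_⟩, ?_, ?_, fun a ha => ha.2⟩
  · rintro a ⟨ha, ha'⟩ g
    refine ⟨hBn.conj_mem a ha g, ?_⟩
    rw [conj_pow, ha', mul_one, mul_inv_cancel]
  · intro h
    have hxA : (x : G) ∈ A := by
      refine ⟨x.2, ?_⟩
      have := pow_orderOf_eq_one x
      rw [hx] at this
      exact_mod_cast congrArg Subtype.val this
    rw [h, Subgroup.mem_bot] at hxA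
    have : x = 1 := Subtype.ext hxA
    rw [this, orderOf_one] at hx
    exact hr.one_lt.ne hx
  · intro a ha b hb
    exact hcomm a ha.1 b hb.1

theorem card_invariant_sets_of_prime_orderOf {Ω : Type*} [Finite Ω] {G : Subgroup (Equiv.Perm Ω)}
    {r : ℕ} (hr : r.Prime) (g : G) (hg : orderOf g = r) :
    ∃ c : ℕ, Nat.card {Γ : Set Ω // g • Γ = Γ} = 2 ^ c ∧
      r * c = Nat.card Ω + (r - 1) * Nat.card {x : Ω // g • x = x} := by
  classical
  have := Fintype.ofFinite Ω
  set Z := Subgroup.zpowers g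
  have : Fintype Z := Fintype.ofFinite _
  refine ⟨Nat.card (MulAction.orbitRel.Quotient Z Ω), ?_, ?_⟩
  · have hZ : ∀ Γ : Set Ω, g • Γ = Γ → ∀ z : Z, z • Γ = Γ := by
      intro Γ hΓ z
      have : Z ≤ MulAction.stabilizer G Γ := by
        rw [Subgroup.zpowers_le]; exact hΓ
      exact this z.2
    let gz : Z := ⟨g, Subgroup.mem_zpowers g⟩
    have e : {Γ : Set Ω // g • Γ = Γ} ≃ Set (MulAction.orbitRel.Quotient Z Ω) :=
      { toFun := fun Γ => (Quotient.mk'' : Ω → MulAction.orbitRel.Quotient Z Ω) '' Γ.1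
        invFun := fun T => ⟨(Quotient.mk'' : Ω → MulAction.orbitRel.Quotient Z Ω) ⁻¹' T, by
          ext x
          rw [Set.mem_smul_set_iff_inv_smul_mem]
          simp only [Set.mem_preimage]
          have : (Quotient.mk'' (g⁻¹ • x) : MulAction.orbitRel.Quotient Z Ω) = Quotient.mk'' x :=
            Quotient.sound' ⟨gz⁻¹, rfl⟩
          rw [this]⟩
        left_inv := by
          rintro ⟨Γ, hΓ⟩
          ext x
          simp only [Set.mem_preimage, Set.mem_image]
          constructor
          · rintro ⟨y, hy, hxy⟩
            obtain ⟨z, hz⟩ := Quotient.exact' hxy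
            have h2 := hZ Γ hΓ z⁻¹
            rw [← h2, Set.mem_smul_set_iff_inv_smul_mem, inv_inv]
            simp only at hz
            rwa [← hz] at hy
          · intro hx
            exact ⟨x, hx, rfl⟩
        right_inv := by
          intro T
          exact Set.image_preimage_eq T Quotient.mk''_surjective }
    rw [Nat.card_congr e, Nat.card_eq_fintype_card, Fintype.card_set, Nat.card_eq_fintype_card]
  · have hb := MulAction.sum_card_fixedBy_eq_card_orbits_mul_card_group Z Ω
    have hcZ : Fintype.card Z = r := by
      rw [← Nat.card_eq_fintype_card, Nat.card_zpowers, hg]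
    rw [hcZ, ← Nat.card_eq_fintype_card (α := Quotient _)] at hb
    rw [mul_comm]
    change _ = _ * r at hb
    rw [← hb, ← Finset.add_sum_erase _ _ (Finset.mem_univ (1 : Z))]
    congr 1
    · rw [Nat.card_eq_fintype_card]
      refine Fintype.card_congr ?_
      exact Equiv.subtypeUnivEquiv (p := fun x : Ω => x ∈ MulAction.fixedBy Ω (1 : Z))
        (fun x : Ω => one_smul Z x)
    · rw [Finset.sum_congr rfl (g := fun _ => Nat.card {x : Ω // g • x = x}) ?_]
      · rw [Finset.sum_const, Finset.card_erase_of_mem (Finset.mem_univ _), Finset.card_univ, hcZ,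
          smul_eq_mul]
      · intro z hz
        have hz1 : z ≠ 1 := (Finset.mem_erase.1 hz).1
        rw [← Nat.card_eq_fintype_card]
        refine Nat.card_congr (Equiv.subtypeEquivRight fun x => ?_)
        have := Fact.mk hr
        have hzg : Subgroup.zpowers (z : G) = Z := by
          refine Subgroup.eq_of_le_of_card_ge ?_ ?_
          · rw [Subgroup.zpowers_le]; exact z.2
          · have h1 : orderOf (z : G) ∣ r := by
              rw [← hcZ, Subgroup.orderOf_coe]; exact orderOf_dvd_card
            rcases (Nat.dvd_prime hr).1 h1 with h | h
            · rw [orderOf_eq_one_iff] at h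
              exact absurd (Subtype.ext h) hz1
            · rw [Nat.card_zpowers, Nat.card_zpowers, h, hg]
        have key : (z : G) ∈ MulAction.stabilizer G x ↔ g ∈ MulAction.stabilizer G x := by
          rw [← Subgroup.zpowers_le, hzg, Subgroup.zpowers_le]
        exact key

/-- Automorphisms of a commutative group whose additive version is a `ZMod q`-module, as linear
automorphisms. -/
def mulAutToZModLinear (C : Type*) [CommGroup C] (q : ℕ) [Module (ZMod q) (Additive C)] :
    MulAut C →* (Additive C ≃ₗ[ZMod q] Additive C) where
  toFun f := { (MulEquiv.toAdditive f) with map_smul' := ZMod.map_smul (MulEquiv.toAdditive f) }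
  map_one' := rfl
  map_mul' _ _ := rfl

theorem exists_affine_coordinates_of_regular.{u} {Ω C : Type u} {G : Type*} [Group G]
    [MulAction G Ω] [CommGroup C] [Finite C] (q : ℕ) (hq : q.Prime) (hCq : ∀ c : C, c ^ q = 1)
    (ι : C →* G) (ψ : G →* MulAut C) (hψ : ∀ g c, ι (ψ g c) = g * ι c * g⁻¹) (ω₀ : Ω)
    (hreg : Function.Bijective fun c : C => ι c • ω₀)
    (hmin : ∀ N : Subgroup C, (∀ g, ∀ c ∈ N, ψ g c ∈ N) → N ≠ ⊥ →
      ∀ ω : Ω, ∃ c ∈ N, ι c • ω₀ = ω) :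
    ∃ (q : ℕ) (_ : Fact q.Prime) (V : Type u) (_ : AddCommGroup V) (_ : Finite V)
      (_ : Module (ZMod q) V) (e : V ≃ Ω) (ρ : G →* (V ≃ₗ[ZMod q] V)),
      (∀ g v, e.symm (g • e v) = ρ g v + e.symm (g • e 0)) ∧
      ∀ W : Submodule (ZMod q) V, (∀ g, ∀ w ∈ W, ρ g w ∈ W) → W = ⊥ ∨ W = ⊤ := by
  obtain ⟨_⟩ : Nonempty (Module (ZMod q) (Additive C)) :=
    ⟨AddCommGroup.zmodModule (fun x => hCq x.toMul)⟩
  let e : Additive C ≃ Ω := Equiv.ofBijective (fun a => ι a.toMul • ω₀) hreg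
  let conj : G →* (Additive C ≃ₗ[ZMod q] Additive C) := (mulAutToZModLinear C q).comp ψ
  refine ⟨q, ⟨hq⟩, Additive C, inferInstance, inferInstance, inferInstance, e, conj, ?_, ?_⟩
  · intro g v
    rw [Equiv.symm_apply_eq]
    obtain ⟨c, hc⟩ := e.surjective (g • e 0)
    rw [← hc, Equiv.symm_apply_apply]
    change g • (ι v.toMul • ω₀) = ι (ψ g v.toMul * c.toMul) • ω₀
    have hc' : ι c.toMul • ω₀ = g • (ι (1 : C) • ω₀) := hc
    rw [map_mul, hψ, mul_smul, hc', map_one, one_smul, smul_smul, smul_smul]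
    simp
  · intro W hW
    refine or_iff_not_imp_left.2 fun hb => ?_
    let N : Subgroup C :=
      { carrier := {a | Additive.ofMul a ∈ W}
        one_mem' := W.zero_mem
        mul_mem' := fun ha hb => W.add_mem ha hb
        inv_mem' := fun ha => W.neg_mem ha }
    have hN0 : N ≠ ⊥ := by
      intro h
      refine hb ((Submodule.eq_bot_iff W).2 fun w hw => ?_)
      have : w.toMul ∈ N := hw
      rw [h, Subgroup.mem_bot] at this
      exact this
    refine (Submodule.eq_top_iff').2 fun v => ?_
    obtain ⟨c, hcW, hc⟩ := hmin N (fun g c hc => hW g _ hc) hN0 (e v)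
    have : c = v.toMul := hreg.injective hc
    rw [this] at hcW
    exact hcW

open scoped IsMulCommutative in
theorem exists_affine_coordinates.{u} {Ω : Type u} [Finite Ω] [Nontrivial Ω]
    (G : Subgroup (Equiv.Perm Ω)) (hG : Group.IsSolvable G) (hprim : MulAction.IsPreprimitive G Ω) :
    ∃ (q : ℕ) (_ : Fact q.Prime) (V : Type u) (_ : AddCommGroup V) (_ : Finite V)
      (_ : Module (ZMod q) V) (e : V ≃ Ω) (ρ : G →* (V ≃ₗ[ZMod q] V)),
      (∀ g v, e.symm (g • e v) = ρ g v + e.symm (g • e 0)) ∧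
      ∀ W : Submodule (ZMod q) V, (∀ g, ∀ w ∈ W, ρ g w ∈ W) → W = ⊥ ∨ W = ⊤ := by
  have hGnt : Nontrivial G := by
    obtain ⟨x, y, hxy⟩ := exists_pair_ne Ω
    obtain ⟨g, hg⟩ := MulAction.exists_smul_eq G x y
    refine ⟨g, 1, fun h => hxy ?_⟩
    rw [← hg, h, one_smul]
  obtain ⟨q, T, hq, hTn, hTne, hTc, hTq⟩ := exists_normal_elementary_abelian G hG
  have htrans : ∀ N : Subgroup G, N.Normal → N ≠ ⊥ → MulAction.IsPretransitive N Ω := by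
    intro N hN hN0
    refine MulAction.IsQuasiPreprimitive.isPretransitive_of_normal (G := G) (X := Ω) ?_
    intro h
    refine hN0 ((Subgroup.eq_bot_iff_forall N).2 fun x hx => ?_)
    refine Subtype.ext (Equiv.ext fun ω => ?_)
    have : ω ∈ MulAction.fixedPoints N Ω := h ▸ Set.mem_univ ω
    exact this ⟨x, hx⟩
  have hTt := htrans T hTn hTne
  have hfree : ∀ a ∈ T, ∀ b ∈ T, ∀ x : Ω, a • x = b • x → a = b := by
    intro a ha b hb x hab
    refine Subtype.ext (Equiv.ext fun ω => ?_)
    obtain ⟨c, hc⟩ := MulAction.exists_smul_eq T x ω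
    change a • ω = b • ω
    rw [← hc]
    change a • ((c : G) • x) = b • ((c : G) • x)
    rw [smul_smul, smul_smul, hTc a ha c c.2, hTc b hb c c.2, ← smul_smul, ← smul_smul, hab]
  have : IsMulCommutative T := ⟨⟨fun a b => Subtype.ext (hTc a a.2 b b.2)⟩⟩
  obtain ⟨ω₀⟩ : Nonempty Ω := inferInstance
  have hreg : Function.Bijective fun c : T => (c : G) • ω₀ := by
    refine ⟨fun a b hab => Subtype.ext (hfree _ a.2 _ b.2 ω₀ hab), fun ω => ?_⟩
    obtain ⟨c, hc⟩ := MulAction.exists_smul_eq T ω₀ ω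
    exact ⟨c, hc⟩
  refine exists_affine_coordinates_of_regular (C := T) q hq (fun c => Subtype.ext (hTq c c.2))
    T.subtype MulAut.conjNormal (fun g c => MulAut.conjNormal_apply g c) ω₀ hreg ?_
  intro N hN hN0 ω
  have hMn : (N.map T.subtype).Normal := ⟨by
    rintro _ ⟨c, hc, rfl⟩ g
    exact ⟨_, hN g c hc, MulAut.conjNormal_apply g c⟩⟩
  have := htrans (N.map T.subtype) hMn
    (fun h => hN0 ((Subgroup.map_eq_bot_iff_of_injective N T.subtype_injective).1 h))
  obtain ⟨⟨_, c, hc, rfl⟩, hcω⟩ := MulAction.exists_smul_eq (N.map T.subtype) ω₀ ω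
  exact ⟨c, hc, hcω⟩

theorem ncard_pairs_eq_sum {Ω : Type*} [Finite Ω] (G : Subgroup (Equiv.Perm Ω)) (T : Finset G) :
    {x : G × Set Ω | x.1 ∈ T ∧ x.1 • x.2 = x.2}.ncard =
      ∑ g ∈ T, Nat.card {Γ : Set Ω // g • Γ = Γ} := by
  classical
  have hfin : ∀ g : G, Set.Finite {Γ : Set Ω | g • Γ = Γ} := fun g => Set.toFinite _
  have h1 : {x : G × Set Ω | x.1 ∈ T ∧ x.1 • x.2 = x.2} =
      ((T.sigma fun g => (hfin g).toFinset).image fun x : (_ : G) × Set Ω => (x.1, x.2) :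
        Finset (G × Set Ω)) := by
    ext ⟨g, Γ⟩
    simp
  rw [h1, Set.ncard_coe_finset, Finset.card_image_of_injective, Finset.card_sigma]
  · refine Finset.sum_congr rfl fun g _ => ?_
    rw [← Set.ncard_eq_toFinset_card _ (hfin g)]
    exact (Nat.card_coe_set_eq _).symm
  · rintro ⟨a, b⟩ ⟨c, d⟩ h
    simpa using h

section Affine

variable {Ω : Type*} {G : Subgroup (Equiv.Perm Ω)} {q : ℕ} {V : Type*} [AddCommGroup V]
  [Module (ZMod q) V] (e : V ≃ Ω) (ρ : G →* (V ≃ₗ[ZMod q] V))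
  (hρ : ∀ g v, e.symm (g • e v) = ρ g v + e.symm (g • e 0))

include hρ

theorem eq_of_linear_part_eq {g h : G} (hgh : ρ g = ρ h) {x : Ω} (hx : g • x = h • x) : g = h := by
  have h0 : e.symm (g • e 0) = e.symm (h • e 0) := by
    have h1 := hρ g (e.symm x)
    have h2 := hρ h (e.symm x)
    rw [Equiv.apply_symm_apply] at h1 h2
    rw [hx, h2, hgh] at h1
    exact (add_left_cancel h1).symm
  refine Subtype.ext (Equiv.ext fun y => ?_)
  refine e.symm.injective ?_
  have h1 := hρ g (e.symm y)
  have h2 := hρ h (e.symm y)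
  rw [Equiv.apply_symm_apply] at h1 h2
  change e.symm (g • y) = e.symm (h • y)
  rw [h1, h2, hgh, h0]

theorem card_fixedBy_eq_zero_or [Finite V] [Fact q.Prime] (g : G) :
    Nat.card {x : Ω // g • x = x} = 0 ∨ Nat.card {x : Ω // g • x = x} =
      q ^ Module.finrank (ZMod q) (LinearMap.ker ((ρ g).toLinearMap - LinearMap.id)) := by
  have hfix : ∀ v, g • e v = e v ↔ v = ρ g v + e.symm (g • e 0) := fun v => by
    rw [← hρ, Equiv.eq_symm_apply, eq_comm]
  rcases isEmpty_or_nonempty {x : Ω // g • x = x} with hE | ⟨⟨x₀, hx₀⟩⟩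
  · left; exact Nat.card_of_isEmpty
  right
  obtain ⟨v₀, rfl⟩ := e.surjective x₀
  rw [hfix] at hx₀
  let F : {x : Ω // g • x = x} ≃ LinearMap.ker ((ρ g).toLinearMap - LinearMap.id) :=
    { toFun := fun x => ⟨e.symm x - v₀, by
        have h1 := hρ g (e.symm x)
        rw [Equiv.apply_symm_apply, x.2] at h1
        rw [LinearMap.mem_ker, LinearMap.sub_apply, LinearMap.id_apply, LinearEquiv.coe_coe,
          map_sub, sub_eq_zero]
        have h2 := congrArg₂ (· - ·) h1 hx₀
        simp only [add_sub_add_right_eq_sub] at h2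
        exact h2.symm⟩
      invFun := fun w => ⟨e (w + v₀), by
        have h1 := w.2
        rw [LinearMap.mem_ker, LinearMap.sub_apply, LinearMap.id_apply, LinearEquiv.coe_coe,
          sub_eq_zero] at h1
        rw [hfix, map_add, h1, add_assoc, ← hx₀]⟩
      left_inv := fun x => by simp
      right_inv := fun w => by simp }
  rw [Nat.card_congr F, Module.natCard_eq_pow_finrank (K := ZMod q), Nat.card_zmod]

theorem card_mul_le_of_fixed_points [Finite Ω] [Finite V] (T : Finset G) (m : ℕ)
    (hT : ∀ g ∈ T, m ≤ Nat.card {x : Ω // g • x = x}) (𝓛 : Set (V ≃ₗ[ZMod q] V))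
    (hL : ∀ g ∈ T, ρ g ∈ 𝓛) :
    T.card * m ≤ Nat.card 𝓛 * Nat.card Ω := by
  classical
  have := Fintype.ofFinite Ω
  have : Finite (V ≃ₗ[ZMod q] V) := Finite.of_injective (fun f => (f : V → V))
    DFunLike.coe_injective
  have := Fintype.ofFinite 𝓛
  let P : Finset ((_ : G) × Ω) := T.sigma fun g => Finset.univ.filter fun x => g • x = x
  have hP : T.card * m ≤ P.card := by
    rw [Finset.card_sigma, ← smul_eq_mul]
    refine Finset.card_nsmul_le_sum _ _ _ fun g hg => ?_
    have := hT g hg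
    rwa [Nat.card_eq_fintype_card, Fintype.card_subtype] at this
  refine hP.trans ?_
  have h𝓛 : P.card ≤ (Finset.univ : Finset 𝓛).card * (Finset.univ : Finset Ω).card := by
    rw [← Finset.card_product]
    have hmem : ∀ p ∈ P, ρ p.1 ∈ 𝓛 ∧ p.1 • p.2 = p.2 := by
      intro p hp
      simp only [P, Finset.mem_sigma, Finset.mem_filter, Finset.mem_univ, true_and] at hp
      exact ⟨hL _ hp.1, hp.2⟩
    rw [← Finset.card_attach (s := P)]
    refine Finset.card_le_card_of_injOn (fun p => (⟨ρ p.1.1, (hmem p.1 p.2).1⟩, p.1.2))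
      (by simp) ?_
    rintro ⟨⟨g, x⟩, hp⟩ - ⟨⟨h, y⟩, hp'⟩ - heq
    have hxy : x = y := congrArg Prod.snd heq
    have hgh : ρ g = ρ h := congrArg Subtype.val (congrArg Prod.fst heq)
    subst hxy
    have := eq_of_linear_part_eq e ρ hρ hgh (x := x)
      ((hmem _ hp).2.trans (hmem _ hp').2.symm)
    subst this
    rfl
  rwa [Finset.card_univ, Finset.card_univ, ← Nat.card_eq_fintype_card,
    ← Nat.card_eq_fintype_card] at h𝓛

theorem card_le_mul_of_linear_part [Finite Ω] [Finite V] (T : Finset G) (𝓛 : Set (V ≃ₗ[ZMod q] V))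
    (hL : ∀ g ∈ T, ρ g ∈ 𝓛) : T.card ≤ Nat.card 𝓛 * Nat.card Ω := by
  have : Finite (V ≃ₗ[ZMod q] V) := Finite.of_injective (fun f => (f : V → V))
    DFunLike.coe_injective
  have hT : T.card = Nat.card T := by simp
  rw [hT, ← Nat.card_prod]
  refine Nat.card_le_card_of_injective
    (fun g : T => ((⟨ρ g, hL g g.2⟩, (g : G) • e 0) : 𝓛 × Ω)) ?_
  intro g h hgh
  refine Subtype.ext (eq_of_linear_part_eq e ρ hρ ?_ (congrArg Prod.snd hgh))
  exact congrArg Subtype.val (congrArg Prod.fst hgh)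

theorem finrank_ker_lt [Finite V] [Fact q.Prime] {g : G} (hg : g ≠ 1)
    (h0 : Nat.card {x : Ω // g • x = x} ≠ 0) :
    Module.finrank (ZMod q) (LinearMap.ker ((ρ g).toLinearMap - LinearMap.id)) <
      Module.finrank (ZMod q) V := by
  refine lt_of_le_of_ne (Submodule.finrank_le _) fun h => hg ?_
  have htop := Submodule.eq_top_of_finrank_eq h
  have hne : Nonempty {x : Ω // g • x = x} := by
    by_contra hn
    rw [not_nonempty_iff] at hn
    exact h0 Nat.card_of_isEmpty
  obtain ⟨x, hx⟩ := hne
  refine eq_of_linear_part_eq e ρ hρ (x := x) ?_ (by rw [hx, one_smul])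
  rw [map_one]
  refine LinearEquiv.ext fun v => ?_
  have : v ∈ LinearMap.ker ((ρ g).toLinearMap - LinearMap.id) := htop ▸ Submodule.mem_top
  rw [LinearMap.mem_ker, LinearMap.sub_apply, sub_eq_zero] at this
  exact this

end Affine

theorem exists_commutative_conj_invariant_subalgebra {V : Type*} [AddCommGroup V]
    [Module (ZMod 2) V] [Finite V] (H : Subgroup (V ≃ₗ[ZMod 2] V)) [Nontrivial H]
    (hH : Group.IsSolvable H)
    (hirr : ∀ W : Submodule (ZMod 2) V, (∀ h ∈ H, ∀ w ∈ W, h w ∈ W) → W = ⊥ ∨ W = ⊤) :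
    ∃ (R : Subalgebra (ZMod 2) (Module.End (ZMod 2) V)) (N : ℕ), 1 ≤ N ∧
      (∀ x ∈ R, ∀ y ∈ R, x * y = y * x) ∧ (∀ x ∈ R, x ^ (N + 1) = x) ∧
      (∀ h ∈ H, ∀ x ∈ R, h.conjAlgEquiv (ZMod 2) x ∈ R) ∧
      ∃ a : V ≃ₗ[ZMod 2] V, a ≠ 1 ∧ a.toLinearMap ∈ R := by
  have : Finite (V ≃ₗ[ZMod 2] V) := Finite.of_injective (fun f => (f : V → V))
    DFunLike.coe_injective
  obtain ⟨r, A, hr, hAn, hAne, hAc, hAr⟩ := exists_normal_elementary_abelian H hH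
  obtain ⟨⟨a, haA⟩, ha⟩ := Subgroup.ne_bot_iff_exists_ne_one.1 hAne
  have ha1 : a ≠ 1 := fun h => ha (Subtype.ext h)
  have ha1' : (a : V ≃ₗ[ZMod 2] V) ≠ 1 := fun h => ha1 (Subtype.ext h)
  have hVnt : Nontrivial V := by
    by_contra h
    rw [not_nontrivial_iff_subsingleton] at h
    exact ha1' (LinearEquiv.ext fun v => Subsingleton.elim _ _)
  have hr2 : r ≠ 2 := by
    rintro rfl
    have hpg : IsPGroup 2 A := fun x => ⟨1, by simpa using Subtype.ext (hAr x x.2)⟩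
    have hdvd : 2 ∣ Nat.card V := by
      rw [Module.natCard_eq_pow_finrank (K := ZMod 2), Nat.card_zmod]
      exact dvd_pow_self _ Module.finrank_pos.ne'
    obtain ⟨w, hw, hw0⟩ := hpg.exists_fixed_point_of_prime_dvd_card_of_fixed_point V hdvd
      (a := 0) (fun x => map_zero ((x : H) : V ≃ₗ[ZMod 2] V))
    let W : Submodule (ZMod 2) V :=
      { carrier := {v | ∀ x ∈ A, (x : V ≃ₗ[ZMod 2] V) v = v}
        zero_mem' := fun x _ => map_zero (x : V ≃ₗ[ZMod 2] V)
        add_mem' := fun hu hv x hx => by rw [map_add, hu x hx, hv x hx]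
        smul_mem' := fun c v hv x hx => by rw [map_smul, hv x hx] }
    have hWinv : ∀ h ∈ H, ∀ v ∈ W, h v ∈ W := fun h hh v hv x hx => by
      have h1 := hv _ (hAn.conj_mem' x hx ⟨h, hh⟩)
      have h2 : h ((h⁻¹ * (x : V ≃ₗ[ZMod 2] V) * h) v) = h v := congrArg h h1
      nth_rw 2 [← h2]
      change _ = (h * (h⁻¹ * (x : V ≃ₗ[ZMod 2] V) * h)) v
      rw [← mul_assoc, ← mul_assoc, mul_inv_cancel, one_mul]
      rfl
    rcases hirr W hWinv with hW | hW
    · have : w ∈ W := fun x hx => hw ⟨x, hx⟩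
      rw [hW, Submodule.mem_bot] at this
      exact hw0 this.symm
    · refine ha1' (LinearEquiv.ext fun v => ?_)
      have : v ∈ W := hW ▸ Submodule.mem_top
      exact this a haA
  let s : Set (Module.End (ZMod 2) V) := (fun x : H => (x : V ≃ₗ[ZMod 2] V).toLinearMap) '' A
  have hs : ∀ x ∈ s, ∀ y ∈ s, x * y = y * x := by
    rintro _ ⟨x, hx, rfl⟩ _ ⟨y, hy, rfl⟩
    have := hAc x hx y hy
    exact congrArg (fun z : H => (z : V ≃ₗ[ZMod 2] V).toLinearMap) this
  have hcomm : ∀ x ∈ Algebra.adjoin (ZMod 2) s, ∀ y ∈ Algebra.adjoin (ZMod 2) s,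
      x * y = y * x := fun x hx y hy =>
    congrArg Subtype.val
      ((Algebra.isMulCommutative_adjoin (ZMod 2) hs).is_comm.comm ⟨x, hx⟩ ⟨y, hy⟩)
  have hr3 : 2 ≤ r - 1 := by have := hr.two_le; omega
  have hpow : 2 ≤ 2 ^ (r - 1) := by
    calc 2 = 2 ^ 1 := rfl
      _ ≤ 2 ^ (r - 1) := Nat.pow_le_pow_right (by norm_num) (by omega)
  refine ⟨Algebra.adjoin (ZMod 2) s, 2 ^ (r - 1) - 1, by omega, hcomm, ?_, ?_, a, ha1',
    Algebra.subset_adjoin ⟨a, haA, rfl⟩⟩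
  · rw [Nat.sub_add_cancel (by omega)]
    intro x hx
    have : CharP (Module.End (ZMod 2) V) 2 := charP_of_injective_algebraMap
      (algebraMap (ZMod 2) _).injective 2
    induction hx using Algebra.adjoin_induction with
    | mem x hx =>
      obtain ⟨y, hy, rfl⟩ := hx
      have hy1 : ((y : V ≃ₗ[ZMod 2] V).toLinearMap : Module.End (ZMod 2) V) ^ r = 1 := by
        have h1 : ((y : V ≃ₗ[ZMod 2] V)) ^ r = 1 := congrArg Subtype.val (hAr y hy)
        have h2 : ∀ k : ℕ, ((y : V ≃ₗ[ZMod 2] V).toLinearMap : Module.End (ZMod 2) V) ^ k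
            = ((y : V ≃ₗ[ZMod 2] V) ^ k : V ≃ₗ[ZMod 2] V).toLinearMap := by
          intro k
          induction k with
          | zero => rfl
          | succ k ih => rw [pow_succ, ih, pow_succ]; rfl
        rw [h2, h1]; rfl
      have hfermat : 2 ^ (r - 1) % r = 1 % r := by
        have := Nat.ModEq.pow_totient (x := 2) (n := r) ((Nat.coprime_primes Nat.prime_two hr).2
          hr2.symm)
        rwa [Nat.totient_prime hr] at this
      rw [Nat.mod_eq_of_lt hr.one_lt] at hfermat
      rw [← Nat.div_add_mod (2 ^ (r - 1)) r, hfermat, pow_add, pow_mul, hy1, one_pow, one_mul,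
        pow_one]
    | algebraMap c => rw [← map_pow, ZMod.pow_card_pow]
    | add x y hx hy ihx ihy =>
      rw [add_pow_char_pow_of_commute 2 (r - 1) (hcomm x hx y hy), ihx, ihy]
    | mul x y hx hy ihx ihy =>
      rw [Commute.mul_pow (hcomm x hx y hy), ihx, ihy]
  · intro h hh x hx
    induction hx using Algebra.adjoin_induction with
    | mem x hx =>
      obtain ⟨y, hy, rfl⟩ := hx
      exact Algebra.subset_adjoin ⟨_, hAn.conj_mem y hy ⟨h, hh⟩, rfl⟩
    | algebraMap c => rw [AlgEquiv.commutes]; exact Subalgebra.algebraMap_mem _ c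
    | add x y hx hy ihx ihy => rw [map_add]; exact add_mem ihx ihy
    | mul x y hx hy ihx ihy => rw [map_mul]; exact mul_mem ihx ihy

theorem exists_conj_orbit_sum_eq_one {V : Type*} [AddCommGroup V]
    [Module (ZMod 2) V] [Finite V] [Nontrivial V] (H : Subgroup (V ≃ₗ[ZMod 2] V))
    (hirr : ∀ W : Submodule (ZMod 2) V, (∀ h ∈ H, ∀ w ∈ W, h w ∈ W) → W = ⊥ ∨ W = ⊤)
    (R : Subalgebra (ZMod 2) (Module.End (ZMod 2) V))
    (hcomm : ∀ x ∈ R, ∀ y ∈ R, x * y = y * x)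
    (hconj : ∀ h ∈ H, ∀ x ∈ R, h.conjAlgEquiv (ZMod 2) x ∈ R) :
    ∃ (ε : Module.End (ZMod 2) V) (O : Finset (Module.End (ZMod 2) V)), ε ∈ R ∧ ε * ε = ε ∧
      ε ≠ 0 ∧ (∀ u ∈ R, u * u = u → ε * u = 0 ∨ ε * u = ε) ∧
      (∀ o, o ∈ O ↔ ∃ h ∈ H, h.conjAlgEquiv (ZMod 2) ε = o) ∧
      (∀ o ∈ O, ∀ o' ∈ O, o ≠ o' → o * o' = 0) ∧ ∑ o ∈ O, o = 1 := by
  classical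
  have : Finite (Module.End (ZMod 2) V) := Finite.of_injective (fun f => (f : V → V))
    DFunLike.coe_injective
  let E : Set (Module.End (ZMod 2) V) := {x | x ∈ R ∧ x * x = x ∧ x ≠ 0}
  have hE : E.Nonempty := ⟨1, one_mem R, one_mul 1, one_ne_zero⟩
  obtain ⟨ε, ⟨hεR, hεε, hε0⟩, hmin⟩ := Set.exists_min_image E
    (fun x => Module.finrank (ZMod 2) (LinearMap.range x)) (Set.toFinite E) hE
  have hprim : ∀ u ∈ R, u * u = u → ε * u = 0 ∨ ε * u = ε := by
    intro u hu huu
    refine or_iff_not_imp_left.2 fun h0 => ?_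
    have hidem : ε * u * (ε * u) = ε * u := by
      rw [mul_assoc, ← mul_assoc u, hcomm u hu ε hεR, mul_assoc ε u u, huu, ← mul_assoc, hεε]
    have hle := hmin (ε * u) ⟨mul_mem hεR hu, hidem, h0⟩
    have hrange : LinearMap.range (ε * u) = LinearMap.range ε :=
      Submodule.eq_of_le_of_finrank_le (LinearMap.range_comp_le_range u ε) hle
    have h1 : ε * u * ε = ε := by
      refine LinearMap.ext fun v => ?_
      have : ε v ∈ LinearMap.range (ε * u) := hrange ▸ LinearMap.mem_range_self ε v
      obtain ⟨w, hw⟩ := this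
      change (ε * u) (ε v) = ε v
      rw [← hw]
      exact LinearMap.congr_fun hidem w
    rw [mul_assoc, hcomm u hu ε hεR, ← mul_assoc, hεε] at h1
    exact h1
  let O : Finset (Module.End (ZMod 2) V) :=
    (Set.toFinite {o | ∃ h ∈ H, h.conjAlgEquiv (ZMod 2) ε = o}).toFinset
  have hO : ∀ o, o ∈ O ↔ ∃ h ∈ H, h.conjAlgEquiv (ZMod 2) ε = o := fun o => by simp [O]
  have hOmul : ∀ h ∈ H, ∀ o ∈ O, h.conjAlgEquiv (ZMod 2) o ∈ O := by
    intro h hh o ho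
    obtain ⟨k, hk, rfl⟩ := (hO o).1 ho
    exact (hO _).2 ⟨h * k, H.mul_mem hh hk, rfl⟩
  have hOR : ∀ o ∈ O, o ∈ R := by
    intro o ho
    obtain ⟨k, hk, rfl⟩ := (hO o).1 ho
    exact hconj k hk ε hεR
  have hOidem : ∀ o ∈ O, o * o = o := by
    intro o ho
    obtain ⟨k, hk, rfl⟩ := (hO o).1 ho
    rw [← map_mul, hεε]
  have hOprim : ∀ o ∈ O, ∀ u ∈ R, u * u = u → o * u = 0 ∨ o * u = o := by
    intro o ho u hu huu
    obtain ⟨k, hk, rfl⟩ := (hO o).1 ho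
    obtain ⟨u, rfl⟩ := (k.conjAlgEquiv (ZMod 2)).surjective u
    rw [← map_mul] at huu
    have hu' : u ∈ R := by
      have := hconj k⁻¹ (H.inv_mem hk) _ hu
      rwa [show k⁻¹.conjAlgEquiv (ZMod 2) (k.conjAlgEquiv (ZMod 2) u) = u from
        (k.conjAlgEquiv (ZMod 2)).symm_apply_apply u] at this
    rcases hprim u hu' ((k.conjAlgEquiv (ZMod 2)).injective huu) with h | h
    · left; rw [← map_mul, h, map_zero]
    · right; rw [← map_mul, h]
  have horth : ∀ o ∈ O, ∀ o' ∈ O, o ≠ o' → o * o' = 0 := by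
    intro o ho o' ho' hne
    rcases hOprim o ho o' (hOR o' ho') (hOidem o' ho') with h | h
    · exact h
    rcases hOprim o' ho' o (hOR o ho) (hOidem o ho) with h' | h'
    · rw [hcomm o (hOR o ho) o' (hOR o' ho'), h']
    · exact absurd (h.symm.trans ((hcomm o (hOR o ho) o' (hOR o' ho')).trans h')) hne
  have hεO : ε ∈ O := (hO ε).2 ⟨1, H.one_mem, rfl⟩
  have hηo : ∀ o ∈ O, o * ∑ o ∈ O, o = o := by
    intro o ho
    rw [Finset.mul_sum, Finset.sum_eq_single o (fun b hb hbo => horth o ho b hb hbo.symm)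
      (fun h => absurd ho h), hOidem o ho]
  refine ⟨ε, O, hεR, hεε, hε0, hprim, hO, horth, ?_⟩
  have hηη : (∑ o ∈ O, o) * ∑ o ∈ O, o = ∑ o ∈ O, o := by
    rw [Finset.sum_mul]
    exact Finset.sum_congr rfl hηo
  have hηh : ∀ h ∈ H, h.conjAlgEquiv (ZMod 2) (∑ o ∈ O, o) = ∑ o ∈ O, o := by
    intro h hh
    rw [map_sum]
    refine Finset.sum_bij (fun o _ => h.conjAlgEquiv (ZMod 2) o) (hOmul h hh)
      (fun a _ b _ hab => (h.conjAlgEquiv (ZMod 2)).injective hab) (fun o ho => ?_)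
      (fun _ _ => rfl)
    exact ⟨h⁻¹.conjAlgEquiv (ZMod 2) o, hOmul _ (H.inv_mem hh) o ho,
      (h.conjAlgEquiv (ZMod 2)).apply_symm_apply o⟩
  generalize (∑ o ∈ O, o) = η at *
  have hWinv : ∀ h ∈ H, ∀ w ∈ LinearMap.range η, h w ∈ LinearMap.range η := by
    rintro h hh _ ⟨v, rfl⟩
    refine ⟨h v, ?_⟩
    have := LinearMap.congr_fun (hηh h hh) (h v)
    rw [← this]
    change h (η (h.symm (h v))) = _
    rw [LinearEquiv.symm_apply_apply]
  rcases hirr _ hWinv with h | h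
  · rw [LinearMap.range_eq_bot] at h
    exact absurd (by rw [← hηo ε hεO, h, mul_zero]) hε0
  · refine LinearMap.ext fun v => ?_
    obtain ⟨w, rfl⟩ := (LinearMap.range_eq_top.1 h) v
    exact LinearMap.congr_fun hηη w

theorem card_le_of_semilinear {K V : Type*} [Field K] [Finite K] [AddCommGroup V] [Module K V]
    [Finite V] [Nontrivial V] (hK : 2 < Nat.card K) {H : Type*} (f : H → (V ≃+ V))
    (hf : Function.Injective f) (hsemi : ∀ h, ∀ x : K, ∃ y : K, ∀ v, f h (x • v) = y • f h v) :
    Nat.card H ≤ (Nat.card K - 2) * Nat.card V ^ Module.finrank K V := by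
  obtain ⟨ζ, hζ⟩ := IsCyclic.exists_generator (α := Kˣ)
  have hζ1 : (ζ : K) ≠ 1 := by
    intro h
    have h1 : ζ = 1 := Units.ext h
    have : Subsingleton Kˣ := ⟨fun a b => by
      have ha := hζ a
      have hb := hζ b
      rw [h1, Subgroup.zpowers_one_eq_bot, Subgroup.mem_bot] at ha hb
      rw [ha, hb]⟩
    have := Nat.card_units K
    rw [Nat.card_of_subsingleton (1 : Kˣ)] at this
    omega
  choose y hy using fun h => hsemi h (ζ : K)
  obtain ⟨v₀, hv₀⟩ := exists_ne (0 : V)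
  have hy0 : ∀ h, y h ≠ 0 := by
    intro h h0
    have := hy h v₀
    rw [h0, zero_smul, map_eq_zero_iff (f h) (f h).injective, smul_eq_zero] at this
    exact this.elim ζ.ne_zero hv₀
  have hy1 : ∀ h, y h ≠ 1 := by
    intro h h1
    have := hy h v₀
    rw [h1, one_smul] at this
    have h2 := (f h).injective this
    have h3 : ((ζ : K) - 1) • v₀ = 0 := by rw [sub_smul, h2, one_smul, sub_self]
    rw [smul_eq_zero, sub_eq_zero] at h3
    exact h3.elim hζ1 hv₀
  let b := Module.finBasis K V
  let F : H → ({y : K // y ≠ 0 ∧ y ≠ 1} × (Fin (Module.finrank K V) → V)) := fun h =>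
    (⟨y h, hy0 h, hy1 h⟩, fun i => f h (b i))
  have hF : Function.Injective F := by
    intro g h hgh
    have h1 : y g = y h := congrArg Subtype.val (congrArg Prod.fst hgh)
    have h2 : ∀ i, f g (b i) = f h (b i) := fun i => congrFun (congrArg Prod.snd hgh) i
    have hstep : ∀ v, f g v = f h v → f g ((ζ : K) • v) = f h ((ζ : K) • v) := by
      intro v hv
      rw [hy, hy, h1, hv]
    have hpow : ∀ (k : ℕ) v, f g v = f h v → f g ((ζ : K) ^ k • v) = f h ((ζ : K) ^ k • v) := by
      intro k
      induction k with
      | zero => intro v hv; simpa using hv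
      | succ k ih =>
        intro v hv
        rw [pow_succ, mul_smul]
        exact ih _ (hstep v hv)
    let W : Submodule K V :=
      { carrier := {v | f g v = f h v}
        zero_mem' := by simp
        add_mem' := fun {u v} hu hv => by
          change f g (u + v) = f h (u + v)
          rw [map_add, map_add, hu, hv]
        smul_mem' := fun c v hv => by
          change f g (c • v) = f h (c • v)
          by_cases hc : c = 0
          · simp [hc]
          · obtain ⟨k, hk⟩ := (mem_powers_iff_mem_zpowers (x := ζ)).2 (hζ (Units.mk0 c hc))
            have : c = (ζ : K) ^ k := by
              have := congrArg Units.val hk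
              simpa using this.symm
            rw [this]
            exact hpow k v hv }
    have hW : W = ⊤ := by
      rw [eq_top_iff, ← b.span_eq, Submodule.span_le]
      rintro _ ⟨i, rfl⟩
      exact h2 i
    refine hf (AddEquiv.ext fun v => ?_)
    have : v ∈ W := hW ▸ Submodule.mem_top
    exact this
  have hcard : Nat.card {y : K // y ≠ 0 ∧ y ≠ 1} = Nat.card K - 2 := by
    classical
    have := Fintype.ofFinite K
    rw [Nat.card_eq_fintype_card, Nat.card_eq_fintype_card, Fintype.card_subtype]
    have h1 : ({x | x ≠ 0 ∧ x ≠ 1} : Finset K) = (Finset.univ.erase 0).erase 1 := by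
      ext x; simp [and_comm]
    rw [h1, Finset.card_erase_of_mem (by simp), Finset.card_erase_of_mem (by simp),
      Finset.card_univ, Nat.sub_sub]
  calc Nat.card H ≤ _ := Nat.card_le_card_of_injective F hF
    _ = _ := by rw [Nat.card_prod, Nat.card_fun, hcard, Nat.card_fin]

theorem card_le_of_commutative_conj_invariant_division {V : Type*} [AddCommGroup V]
    [Module (ZMod 2) V] [Finite V] [Nontrivial V] (H : Subgroup (V ≃ₗ[ZMod 2] V))
    (R : Subalgebra (ZMod 2) (Module.End (ZMod 2) V))
    (hcomm : ∀ x ∈ R, ∀ y ∈ R, x * y = y * x)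
    (hinv : ∀ x ∈ R, x ≠ 0 → ∃ y ∈ R, x * y = 1)
    (hconj : ∀ h ∈ H, ∀ x ∈ R, h.conjAlgEquiv (ZMod 2) x ∈ R)
    (a : V ≃ₗ[ZMod 2] V) (ha1 : a ≠ 1) (haR : a.toLinearMap ∈ R) :
    ∃ e t, 2 ≤ e ∧ Module.finrank (ZMod 2) V = e * t ∧
      Nat.card H ≤ (2 ^ e - 2) * 2 ^ (Module.finrank (ZMod 2) V * t) := by
  have hfield : IsField R :=
    { exists_pair_ne := ⟨0, 1, zero_ne_one⟩
      mul_comm := fun x y => Subtype.ext (hcomm x x.2 y y.2)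
      mul_inv_cancel := fun {x} hx => by
        obtain ⟨y, hy, hxy⟩ := hinv x x.2 (fun h => hx (Subtype.ext h))
        exact ⟨⟨y, hy⟩, Subtype.ext hxy⟩ }
  let _ : Field R := hfield.toField
  have : Finite (Module.End (ZMod 2) V) := Finite.of_injective (fun f => (f : V → V))
    DFunLike.coe_injective
  let _ : Module R V := Module.compHom V R.val.toRingHom
  have hR : Nat.card R = 2 ^ Module.finrank (ZMod 2) R := by
    rw [Module.natCard_eq_pow_finrank (K := ZMod 2), Nat.card_zmod]
  have hR3 : 2 < Nat.card R := by
    have := Fintype.ofFinite R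
    rw [Nat.card_eq_fintype_card, Fintype.two_lt_card_iff]
    refine ⟨0, 1, ⟨_, haR⟩, zero_ne_one, fun h => ?_, fun h => ?_⟩
    · have h' : (0 : Module.End (ZMod 2) V) = a.toLinearMap := congrArg Subtype.val h
      obtain ⟨v, hv⟩ := exists_ne (0 : V)
      refine hv (a.injective ?_)
      rw [map_zero]
      exact (LinearMap.congr_fun h' v).symm
    · have h' : (1 : Module.End (ZMod 2) V) = a.toLinearMap := congrArg Subtype.val h
      exact ha1 (LinearEquiv.ext fun v => (LinearMap.congr_fun h' v).symm)
  have hV : Nat.card V = 2 ^ Module.finrank (ZMod 2) V := by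
    rw [Module.natCard_eq_pow_finrank (K := ZMod 2), Nat.card_zmod]
  have hV' : Nat.card V = Nat.card R ^ Module.finrank R V := Module.natCard_eq_pow_finrank
  have hmain := card_le_of_semilinear (K := R) (V := V) hR3
    (fun h : H => (h : V ≃ₗ[ZMod 2] V).toAddEquiv) (fun g h hgh => by
      refine Subtype.ext (LinearEquiv.ext fun v => ?_)
      exact DFunLike.congr_fun hgh v) (fun h x => by
      refine ⟨⟨_, hconj h h.2 x x.2⟩, fun v => ?_⟩
      change (h : V ≃ₗ[ZMod 2] V) ((x : Module.End (ZMod 2) V) v) =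
        (h : V ≃ₗ[ZMod 2] V) ((x : Module.End (ZMod 2) V) ((h : V ≃ₗ[ZMod 2] V).symm
          ((h : V ≃ₗ[ZMod 2] V) v)))
      rw [LinearEquiv.symm_apply_apply])
  refine ⟨Module.finrank (ZMod 2) R, Module.finrank R V, ?_, ?_, ?_⟩
  · by_contra h
    have : Nat.card R ≤ 2 ^ 1 := hR ▸ Nat.pow_le_pow_right (by norm_num) (by omega)
    omega
  · rw [hR, ← pow_mul, hV] at hV'
    exact Nat.pow_right_injective le_rfl hV'
  · rwa [hR, hV, ← pow_mul] at hmain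

theorem card_le_of_conj_orbit_sum_eq_one {V : Type*} [AddCommGroup V]
    [Module (ZMod 2) V] [Finite V] (H : Subgroup (V ≃ₗ[ZMod 2] V))
    (ε : Module.End (ZMod 2) V) (O : Finset (Module.End (ZMod 2) V)) (hεε : ε * ε = ε)
    (hO : ∀ o, o ∈ O ↔ ∃ h ∈ H, h.conjAlgEquiv (ZMod 2) ε = o)
    (horth : ∀ o ∈ O, ∀ o' ∈ O, o ≠ o' → o * o' = 0) (hsum : ∑ o ∈ O, o = 1) :
    Module.finrank (ZMod 2) V = O.card * Module.finrank (ZMod 2) (LinearMap.range ε) ∧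
      Nat.card H ≤ O.card.factorial *
        2 ^ (Module.finrank (ZMod 2) (LinearMap.range ε) * Module.finrank (ZMod 2) V) := by
  classical
  have hOmul : ∀ h ∈ H, ∀ o ∈ O, h.conjAlgEquiv (ZMod 2) o ∈ O := by
    intro h hh o ho
    obtain ⟨k, hk, rfl⟩ := (hO o).1 ho
    exact (hO _).2 ⟨h * k, H.mul_mem hh hk, rfl⟩
  have hOidem : ∀ o ∈ O, o * o = o := by
    intro o ho
    obtain ⟨k, hk, rfl⟩ := (hO o).1 ho
    rw [← map_mul, hεε]
  have hOmul_iff : ∀ h ∈ H, ∀ o, h.conjAlgEquiv (ZMod 2) o ∈ O ↔ o ∈ O := by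
    intro h hh o
    refine ⟨fun ho => ?_, hOmul h hh o⟩
    have := hOmul _ (H.inv_mem hh) _ ho
    rwa [show h⁻¹.conjAlgEquiv (ZMod 2) (h.conjAlgEquiv (ZMod 2) o) = o from
      (h.conjAlgEquiv (ZMod 2)).symm_apply_apply o] at this
  have hdecomp : ∀ v : V, v = ∑ o ∈ O, o v := by
    intro v
    have := LinearMap.congr_fun hsum v
    rw [LinearMap.sum_apply] at this
    exact this.symm
  choose! g hgH hg using fun o (ho : o ∈ O) => (hO o).1 ho
  have happ : ∀ o ∈ O, ∀ v, o (g o v) = g o (ε v) := by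
    intro o ho v
    have := LinearMap.congr_fun (hg o ho) (g o v)
    rw [← this]
    change g o (ε ((g o).symm (g o v))) = _
    rw [LinearEquiv.symm_apply_apply]
  have hort_app : ∀ o ∈ O, ∀ o' ∈ O, ∀ v, o (g o' (ε v)) = if o = o' then g o (ε v) else 0 := by
    intro o ho o' ho' v
    rw [← happ o' ho' v]
    split_ifs with h
    · subst h
      rw [← happ o ho]
      exact LinearMap.congr_fun (hOidem o ho) _
    · exact LinearMap.congr_fun (horth o ho o' ho' h) _
  constructor
  · let toPi : V →ₗ[ZMod 2] (O → LinearMap.range ε) :=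
      LinearMap.pi fun o => ε.rangeRestrict ∘ₗ (g o).symm.toLinearMap
    have hbij : Function.Bijective toPi := by
      constructor
      · rw [injective_iff_map_eq_zero]
        intro v hv
        rw [hdecomp v]
        refine Finset.sum_eq_zero fun o ho => ?_
        have h1 : ε ((g o).symm v) = 0 := congrArg Subtype.val (congrFun hv ⟨o, ho⟩)
        have h2 := happ o ho ((g o).symm v)
        rwa [LinearEquiv.apply_symm_apply, h1, map_zero] at h2
      · intro f
        refine ⟨∑ o : O, g o (f o), ?_⟩
        funext o
        refine Subtype.ext ?_
        refine (g o).injective ?_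
        change (g o) (ε ((g o).symm _)) = _
        rw [← happ o o.2, LinearEquiv.apply_symm_apply, map_sum, Finset.sum_eq_single o]
        · obtain ⟨u, hu⟩ := (f o).2
          rw [← hu, hort_app o o.2 o o.2, if_pos rfl]
        · intro o' _ hne
          obtain ⟨u, hu⟩ := (f o').2
          rw [← hu, hort_app o o.2 o' o'.2, if_neg (fun h => hne (Subtype.ext h.symm))]
        · simp
    rw [(LinearEquiv.ofBijective toPi hbij).finrank_eq, Module.finrank_pi_fintype]
    simp
  · let perm : H → Equiv.Perm O := fun h =>
      Equiv.Perm.subtypePerm ((h : V ≃ₗ[ZMod 2] V).conjAlgEquiv (ZMod 2)).toEquiv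
        (hOmul_iff h h.2)
    let F : H → Equiv.Perm O × (LinearMap.range ε →ₗ[ZMod 2] V) := fun h =>
      (perm h, (h : V ≃ₗ[ZMod 2] V).toLinearMap ∘ₗ
        (∑ o ∈ O, (g o).toLinearMap) ∘ₗ (LinearMap.range ε).subtype)
    have hF : Function.Injective F := by
      intro h k hhk
      have h1 : ∀ o : O, (h : V ≃ₗ[ZMod 2] V).conjAlgEquiv (ZMod 2) o =
          (k : V ≃ₗ[ZMod 2] V).conjAlgEquiv (ZMod 2) o := fun o =>
        congrArg Subtype.val (Equiv.congr_fun (congrArg Prod.fst hhk) o)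
      have h2 : ∀ v, (h : V ≃ₗ[ZMod 2] V) (∑ o ∈ O, g o (ε v)) =
          (k : V ≃ₗ[ZMod 2] V) (∑ o ∈ O, g o (ε v)) := fun v => by
        have := LinearMap.congr_fun (congrArg Prod.snd hhk) (ε.rangeRestrict v)
        simpa [F, LinearMap.sum_apply] using this
      have h3 : ∀ (h : V ≃ₗ[ZMod 2] V), ∀ o ∈ O, ∀ v,
          (h.conjAlgEquiv (ZMod 2) o) (h (∑ o ∈ O, g o (ε v))) = h (g o (ε v)) := by
        intro h o ho v
        change h (o (h.symm (h _))) = _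
        rw [LinearEquiv.symm_apply_apply, map_sum, Finset.sum_eq_single o, hort_app o ho o ho,
          if_pos rfl]
        · intro o' ho' hne
          rw [hort_app o ho o' ho', if_neg hne.symm]
        · exact fun h => absurd ho h
      refine Subtype.ext (LinearEquiv.ext fun v => ?_)
      rw [hdecomp v, map_sum, map_sum]
      refine Finset.sum_congr rfl fun o ho => ?_
      have h4 := happ o ho ((g o).symm v)
      rw [LinearEquiv.apply_symm_apply] at h4
      rw [h4, ← h3 h o ho, ← h3 k o ho, h2, h1 ⟨o, ho⟩]
    have : Finite (LinearMap.range ε →ₗ[ZMod 2] V) :=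
      Finite.of_injective (fun f => (f : LinearMap.range ε → V)) DFunLike.coe_injective
    calc Nat.card H ≤ _ := Nat.card_le_card_of_injective F hF
      _ = _ := by
        rw [Nat.card_prod, Nat.card_eq_fintype_card, Fintype.card_perm, Fintype.card_coe,
          Module.natCard_eq_pow_finrank (K := ZMod 2) (V := LinearMap.range ε →ₗ[ZMod 2] V),
          Nat.card_zmod, Module.finrank_linearMap]

theorem card_bound_of_irreducible_solvable {V : Type*} [AddCommGroup V]
    [Module (ZMod 2) V] [Finite V] (H : Subgroup (V ≃ₗ[ZMod 2] V)) (hH : Group.IsSolvable H)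
    (hirr : ∀ W : Submodule (ZMod 2) V, (∀ h ∈ H, ∀ w ∈ W, h w ∈ W) → W = ⊥ ∨ W = ⊤) :
    Nat.card H = 1 ∨
    (∃ e t, 2 ≤ e ∧ Module.finrank (ZMod 2) V = e * t ∧
      Nat.card H ≤ (2 ^ e - 2) * 2 ^ (Module.finrank (ZMod 2) V * t)) ∨
    (∃ k m, 2 ≤ k ∧ 2 ≤ m ∧ Module.finrank (ZMod 2) V = k * m ∧
      Nat.card H ≤ k.factorial * 2 ^ (m * Module.finrank (ZMod 2) V)) := by
  rcases subsingleton_or_nontrivial H with hs | hnt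
  · left
    exact Nat.card_of_subsingleton 1
  right
  obtain ⟨R, N, hN, hcomm, hpow, hconj, a, ha1, haR⟩ :=
    exists_commutative_conj_invariant_subalgebra H hH hirr
  have hVnt : Nontrivial V := by
    by_contra h
    rw [not_nontrivial_iff_subsingleton] at h
    exact ha1 (LinearEquiv.ext fun v => Subsingleton.elim _ _)
  obtain ⟨ε, O, hεR, hεε, hε0, hprim, hO, horth, hsum⟩ :=
    exists_conj_orbit_sum_eq_one H hirr R hcomm hconj
  have hεO : ε ∈ O := (hO ε).2 ⟨1, H.one_mem, rfl⟩
  have hOR : ∀ o ∈ O, o ∈ R := by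
    intro o ho
    obtain ⟨k, hk, rfl⟩ := (hO o).1 ho
    exact hconj k hk ε hεR
  by_cases hk : O.card = 1
  · left
    obtain ⟨o, ho⟩ := Finset.card_eq_one.1 hk
    rw [ho, Finset.mem_singleton] at hεO
    rw [ho, Finset.sum_singleton, ← hεO] at hsum
    refine card_le_of_commutative_conj_invariant_division H R hcomm ?_ hconj a ha1 haR
    intro x hx hx0
    have hidem : x ^ N * x ^ N = x ^ N := by
      obtain ⟨M, rfl⟩ : ∃ M, N = M + 1 := ⟨N - 1, by omega⟩
      calc x ^ (M + 1) * x ^ (M + 1) = x ^ M * x ^ (M + 1 + 1) := by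
            rw [← pow_add, ← pow_add]; congr 1; ring
        _ = x ^ (M + 1) := by rw [hpow x hx, pow_succ]
    have hxN : x ^ N = 1 := by
      rcases hprim (x ^ N) (pow_mem hx N) hidem with h | h
      · rw [hsum, one_mul] at h
        refine absurd ?_ hx0
        rw [← hpow x hx, pow_succ, h, zero_mul]
      · rwa [hsum, one_mul] at h
    refine ⟨x ^ (N - 1), pow_mem hx _, ?_⟩
    rw [← pow_succ', Nat.sub_add_cancel hN, hxN]
  · right
    obtain ⟨hd, hcard⟩ := card_le_of_conj_orbit_sum_eq_one H ε O hεε hO horth hsum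
    have hOpos : 0 < O.card := Finset.card_pos.2 ⟨ε, hεO⟩
    have hm0 : Module.finrank (ZMod 2) (LinearMap.range ε) ≠ 0 := by
      intro h
      rw [Submodule.finrank_eq_zero, LinearMap.range_eq_bot] at h
      exact hε0 h
    have hm1 : Module.finrank (ZMod 2) (LinearMap.range ε) ≠ 1 := by
      intro h
      have hone : ∀ x y : V, ε x ≠ 0 → ε y ≠ 0 → ε x = ε y := by
        obtain ⟨w, hw0, hw⟩ := finrank_eq_one_iff'.1 h
        have hall : ∀ x, ε x ≠ 0 → ε x = w := by
          intro x hx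
          obtain ⟨c, hc⟩ := hw ⟨ε x, LinearMap.mem_range_self ε x⟩
          have hc' : c • (w : V) = ε x := congrArg Subtype.val hc
          have h01 : ∀ c : ZMod 2, c = 0 ∨ c = 1 := by decide
          rcases h01 c with rfl | rfl
          · rw [zero_smul] at hc'
            exact absurd hc'.symm hx
          · rw [← hc', one_smul]
        intro x y hx hy
        rw [hall x hx, hall y hy]
      refine ha1 (LinearEquiv.ext fun v => ?_)
      have hdecomp : ∀ v : V, ∑ o ∈ O, o v = v := by
        intro v
        have := LinearMap.congr_fun hsum v
        rwa [LinearMap.sum_apply] at this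
      rw [← hdecomp v, map_sum]
      refine Finset.sum_congr rfl fun o ho => ?_
      change a (o v) = o v
      have hao : a (o v) = o (a v) := LinearMap.congr_fun (hcomm _ haR o (hOR o ho)) v
      by_cases h0 : o v = 0
      · rw [h0, map_zero]
      have h1 : o (a v) ≠ 0 := by
        rw [← hao]
        exact fun h => h0 (by rwa [map_eq_zero_iff a a.injective] at h)
      rw [hao]
      obtain ⟨g, -, rfl⟩ := (hO o).1 ho
      change g (ε (g.symm (a v))) = g (ε (g.symm v))
      change ¬ g (ε (g.symm v)) = 0 at h0
      change g (ε (g.symm (a v))) ≠ 0 at h1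
      rw [map_eq_zero_iff g g.injective] at h0
      rw [ne_eq, map_eq_zero_iff g g.injective] at h1
      rw [hone _ _ h1 h0]
    exact ⟨O.card, _, by omega, by omega, hd, hcard⟩

theorem card_linearEquiv_le_prod {q : ℕ} [Fact q.Prime] {V : Type*} [AddCommGroup V]
    [Module (ZMod q) V] [Finite V] :
    Nat.card (V ≃ₗ[ZMod q] V) ≤ ∏ i : Fin (Module.finrank (ZMod q) V),
      (q ^ Module.finrank (ZMod q) V - q ^ (i : ℕ)) := by
  have := Fintype.ofFinite V
  have h := card_linearIndependent (K := ZMod q) (V := V)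
    (k := Module.finrank (ZMod q) V) le_rfl
  rw [ZMod.card] at h
  rw [← h]
  let b := Module.finBasis (ZMod q) V
  refine Nat.card_le_card_of_injective (fun L : V ≃ₗ[ZMod q] V =>
    (⟨fun i => L (b i), b.linearIndependent.map' L.toLinearMap L.ker⟩ :
      {s : Fin (Module.finrank (ZMod q) V) → V // LinearIndependent (ZMod q) s})) ?_
  intro L M hLM
  have h1 := congrArg Subtype.val hLM
  exact b.ext' fun i => congrFun h1 i

theorem card_linearEquiv_le_pow {q : ℕ} [Fact q.Prime] {V : Type*} [AddCommGroup V]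
    [Module (ZMod q) V] [Finite V] :
    Nat.card (V ≃ₗ[ZMod q] V) ≤
      q ^ (Module.finrank (ZMod q) V * Module.finrank (ZMod q) V) := by
  refine card_linearEquiv_le_prod.trans ?_
  rw [pow_mul]
  calc _ ≤ ∏ _i : Fin (Module.finrank (ZMod q) V), q ^ Module.finrank (ZMod q) V :=
        Finset.prod_le_prod' fun i _ => Nat.sub_le _ _
    _ = _ := by simp

theorem card_transvections_le {q : ℕ} [Fact q.Prime] {V : Type*} [AddCommGroup V]
    [Module (ZMod q) V] [Finite V] :
    Nat.card {L : V ≃ₗ[ZMod q] V | Module.finrank (ZMod q) V ≤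
      Module.finrank (ZMod q) (LinearMap.ker (L.toLinearMap - LinearMap.id)) + 1} ≤
      Nat.card V * Nat.card V := by
  have hfac : ∀ f : V →ₗ[ZMod q] V, Module.finrank (ZMod q) (LinearMap.range f) ≤ 1 →
      ∃ p : (V →ₗ[ZMod q] ZMod q) × V, ∀ v, f v = p.1 v • p.2 := by
    intro f hf
    by_cases hf0 : f = 0
    · exact ⟨(0, 0), fun v => by simp [hf0]⟩
    obtain ⟨⟨w, hwr⟩, hw⟩ := finrank_le_one_iff.1 hf
    have hw0 : w ≠ 0 := by
      rintro rfl
      refine hf0 (LinearMap.ext fun v => ?_)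
      obtain ⟨c, hc⟩ := hw ⟨f v, LinearMap.mem_range_self f v⟩
      have := congrArg Subtype.val hc
      simpa using this.symm
    obtain ⟨φ, hφ⟩ : ∃ φ : Module.Dual (ZMod q) V, φ w ≠ 0 := by
      by_contra! h
      exact hw0 ((Module.forall_dual_apply_eq_zero_iff (ZMod q) w).1 h)
    refine ⟨((φ w)⁻¹ • (φ ∘ₗ f), w), fun v => ?_⟩
    obtain ⟨c, hc⟩ := hw ⟨f v, LinearMap.mem_range_self f v⟩
    have hc' : c • w = f v := congrArg Subtype.val hc
    simp only [LinearMap.smul_apply, LinearMap.comp_apply, ← hc', map_smul, smul_eq_mul]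
    rw [mul_comm c, ← mul_assoc, inv_mul_cancel₀ hφ, one_mul]
  have hfac' : ∀ L : {L : V ≃ₗ[ZMod q] V | Module.finrank (ZMod q) V ≤
      Module.finrank (ZMod q) (LinearMap.ker (L.toLinearMap - LinearMap.id)) + 1},
      ∃ p : (V →ₗ[ZMod q] ZMod q) × V, ∀ v, L.1 v = p.1 v • p.2 + v := by
    rintro ⟨L, hL⟩
    have h1 := LinearMap.finrank_range_add_finrank_ker (L.toLinearMap - LinearMap.id)
    replace hL : Module.finrank (ZMod q) V ≤
      Module.finrank (ZMod q) (LinearMap.ker (L.toLinearMap - LinearMap.id)) + 1 := hL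
    obtain ⟨p, hp⟩ := hfac (L.toLinearMap - LinearMap.id) (by omega)
    refine ⟨p, fun v => ?_⟩
    rw [← hp]
    simp
  choose p hp using hfac'
  have hinj : Function.Injective p := by
    intro L M h
    refine Subtype.ext (LinearEquiv.ext fun v => ?_)
    rw [hp L, hp M, h]
  have : Finite (V →ₗ[ZMod q] ZMod q) := Finite.of_injective (fun f => (f : V → ZMod q))
    DFunLike.coe_injective
  refine (Nat.card_le_card_of_injective p hinj).trans (le_of_eq ?_)
  rw [Nat.card_prod, Module.natCard_eq_pow_finrank (K := ZMod q) (V := V →ₗ[ZMod q] ZMod q),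
    Module.natCard_eq_pow_finrank (K := ZMod q) (V := V), Module.finrank_linearMap,
    Module.finrank_self, mul_one]

theorem card_bound_of_finrank_le_ten {d h : ℕ} (hd : 2 ≤ d)
    (hbound : h = 1 ∨ (∃ e t, 2 ≤ e ∧ d = e * t ∧ h ≤ (2 ^ e - 2) * 2 ^ (d * t)) ∨
      (∃ k m, 2 ≤ k ∧ 2 ≤ m ∧ d = k * m ∧ h ≤ k.factorial * 2 ^ (m * d))) :
    (d = 2 → h ≤ 8) ∧ (d = 3 → h ≤ 48) ∧ (4 ≤ d → d ≤ 10 → h ≤ 2 ^ (d * d / 2 + 1)) := by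
  rcases hbound with rfl | ⟨e, t, he, hde, hh⟩ | ⟨k, m, hk, hm, hdk, hh⟩
  · exact ⟨fun _ => by norm_num, fun _ => by norm_num, fun _ _ => Nat.one_le_two_pow⟩
  · have ht : t ≠ 0 := by rintro rfl; omega
    have hed : e ≤ d := hde ▸ Nat.le_mul_of_pos_right e (Nat.pos_of_ne_zero ht)
    refine ⟨?_, ?_, ?_⟩
    · rintro rfl
      interval_cases e
      obtain rfl : t = 1 := by omega
      exact hh
    · rintro rfl
      interval_cases e
      · omega
      obtain rfl : t = 1 := by omega
      exact hh
    · intro h4 h10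
      refine hh.trans ?_
      have ht5 : t ≤ 5 := by
        by_contra h
        have : 2 * 6 ≤ e * t := Nat.mul_le_mul he (by omega)
        omega
      clear hh
      interval_cases d <;> interval_cases e <;> first
        | (exfalso; omega)
        | (interval_cases t <;> first | (exfalso; omega) | norm_num)
  · have hkd : k * 2 ≤ d := hdk ▸ Nat.mul_le_mul_left k hm
    refine ⟨by omega, by omega, fun h4 h10 => ?_⟩
    refine hh.trans ?_
    have hk5 : k ≤ 5 := by omega
    have hm5 : m ≤ 5 := by
      by_contra h
      have : 2 * 6 ≤ k * m := Nat.mul_le_mul hk (by omega)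
      omega
    clear hh
    interval_cases d <;> interval_cases k <;> first
      | (exfalso; omega)
      | (interval_cases m <;> first | (exfalso; omega) | norm_num [Nat.factorial])

theorem le_rpow_bound_of_pow_le {n X : ℕ} (h : X ^ 36 * 24 ^ 12 ≤ 2 ^ (20 * n) * n ^ 117) :
    (X : ℝ) ≤ (24 : ℝ) ^ (-(1 / 3 : ℝ)) * 2 ^ (5 * (n : ℝ) / 9) * (n : ℝ) ^ ((13 : ℝ) / 4) := by
  have h24 : ((24 : ℝ) ^ (-(1 / 3 : ℝ))) ^ 36 = ((24 : ℝ) ^ 12)⁻¹ := by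
    rw [← Real.rpow_natCast, ← Real.rpow_mul (by norm_num), ← Real.rpow_natCast,
      ← Real.rpow_neg (by norm_num)]
    norm_num
  have h2 : ((2 : ℝ) ^ (5 * (n : ℝ) / 9)) ^ 36 = 2 ^ (20 * n) := by
    rw [← Real.rpow_natCast, ← Real.rpow_mul (by norm_num), ← Real.rpow_natCast]
    congr 1
    push_cast
    ring
  have hn : ((n : ℝ) ^ ((13 : ℝ) / 4)) ^ 36 = (n : ℝ) ^ 117 := by
    rw [← Real.rpow_natCast, ← Real.rpow_mul (Nat.cast_nonneg n), ← Real.rpow_natCast]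
    norm_num
  refine le_of_pow_le_pow_left₀ (n := 36) (by norm_num) (by positivity) ?_
  rw [mul_pow, mul_pow, h24, h2, hn, mul_assoc, inv_mul_eq_div, le_div_iff₀ (by positivity)]
  exact_mod_cast h

theorem bound_of_five_le_prime {q d X c : ℕ} (hq : 5 ≤ q) (hd : 1 ≤ d)
    (hc : 15 * c ≤ 7 * q ^ d) (hX : X ≤ q ^ d * q ^ (d * d) * 2 ^ c) :
    X ^ 36 * 24 ^ 12 ≤ 2 ^ (20 * q ^ d) * (q ^ d) ^ 117 := by
  have h5 : ∀ n : ℕ, n = q ^ d → q ^ (d * (180 * d)) * 24 ^ 60 ≤ 2 ^ (16 * n) * n ^ 405 := by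
    intro n hn
    have hqn : q ≤ n := hn ▸ Nat.le_self_pow (by omega) q
    have hnd : ∀ k, q ^ (d * k) = n ^ k := fun k => by rw [hn, pow_mul]
    rw [hnd]
    rcases Nat.lt_or_ge d 3 with hd3 | hd3
    · interval_cases d
      · calc n ^ (180 * 1) * 24 ^ 60 ≤ n ^ 180 * n ^ 225 := by
              refine Nat.mul_le_mul_left _ ?_
              calc 24 ^ 60 ≤ 5 ^ 225 := by norm_num
                _ ≤ n ^ 225 := Nat.pow_le_pow_left (hq.trans hqn) _
          _ = 1 * n ^ 405 := by ring
          _ ≤ _ := Nat.mul_le_mul_right _ Nat.one_le_two_pow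
      · have h25 : 25 ≤ n := by
          rw [hn]
          calc 25 = 5 ^ 2 := by norm_num
            _ ≤ q ^ 2 := Nat.pow_le_pow_left hq _
        calc n ^ (180 * 2) * 24 ^ 60 ≤ n ^ (180 * 2) * (2 ^ (16 * n) * n ^ 45) := by
              refine Nat.mul_le_mul_left _ ?_
              calc 24 ^ 60 ≤ 2 ^ 200 * 25 ^ 45 := by norm_num
                _ ≤ _ := Nat.mul_le_mul (Nat.pow_le_pow_right (by norm_num) (by omega))
                  (Nat.pow_le_pow_left h25 _)
          _ = _ := by ring
    · have h125 : 125 ≤ n := by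
        rw [hn]
        calc 125 = 5 ^ 3 := by norm_num
          _ ≤ q ^ 3 := Nat.pow_le_pow_left hq _
          _ ≤ q ^ d := Nat.pow_le_pow_right (by omega) hd3
      have h24 : 24 ^ 60 ≤ n ^ 45 := by
        calc 24 ^ 60 ≤ 125 ^ 45 := by norm_num
          _ ≤ _ := Nat.pow_le_pow_left h125 _
      have hq15 : q ^ 15 ≤ 2 ^ (7 * q) := by
        clear * - hq
        induction q, hq using Nat.le_induction with
        | base => norm_num
        | succ q hq ih =>
          have h6 : 5 * (q + 1) ≤ 6 * q := by omega
          have h7 : (5 * (q + 1)) ^ 15 ≤ (6 * q) ^ 15 := Nat.pow_le_pow_left h6 15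
          rw [mul_pow, mul_pow] at h7
          have h8 : 5 ^ 15 * (q + 1) ^ 15 ≤ 5 ^ 15 * (2 ^ 7 * q ^ 15) := by
            refine h7.trans ?_
            rw [← mul_assoc]
            exact Nat.mul_le_mul_right _ (by norm_num)
          have h9 := Nat.le_of_mul_le_mul_left h8 (by norm_num)
          calc (q + 1) ^ 15 ≤ 2 ^ 7 * q ^ 15 := h9
            _ ≤ 2 ^ 7 * 2 ^ (7 * q) := Nat.mul_le_mul_left _ ih
            _ = _ := by rw [← pow_add]; congr 1; ring
      have hexp : 21 * (d * (d - 2)) ≤ 4 * q ^ (d - 1) := by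
        have h5d : 21 * (d * (d - 2)) ≤ 4 * 5 ^ (d - 1) := by
          clear * - hd3
          induction d, hd3 using Nat.le_induction with
          | base => norm_num
          | succ d hd ih =>
            obtain ⟨k, rfl⟩ : ∃ k, d = k + 3 := ⟨d - 3, by omega⟩
            have e1 : k + 3 + 1 - 1 = (k + 3 - 1) + 1 := by omega
            rw [e1, pow_succ]
            have e2 : k + 3 - 2 = k + 1 := by omega
            have e3 : k + 3 + 1 - 2 = k + 2 := by omega
            rw [e2] at ih
            rw [e3]
            nlinarith
        exact h5d.trans (Nat.mul_le_mul_left _ (Nat.pow_le_pow_left hq _))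
      have hmain : n ^ (180 * (d - 2)) ≤ 2 ^ (16 * n) := by
        calc n ^ (180 * (d - 2)) = (q ^ 15) ^ (12 * (d * (d - 2))) := by
              rw [hn, ← pow_mul, ← pow_mul]; congr 1; ring
          _ ≤ (2 ^ (7 * q)) ^ (12 * (d * (d - 2))) := Nat.pow_le_pow_left hq15 _
          _ = 2 ^ (4 * q * (21 * (d * (d - 2)))) := by rw [← pow_mul]; congr 1; ring
          _ ≤ 2 ^ (4 * q * (4 * q ^ (d - 1))) := by
              exact Nat.pow_le_pow_right (by norm_num) (Nat.mul_le_mul_left _ hexp)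
          _ = 2 ^ (16 * n) := by
              rw [hn]
              obtain ⟨k, rfl⟩ : ∃ k, d = k + 1 := ⟨d - 1, by omega⟩
              congr 1
              rw [Nat.add_sub_cancel]
              ring
      have e : 180 * d = 180 * (d - 2) + 360 := by omega
      calc n ^ (180 * d) * 24 ^ 60 ≤ n ^ (180 * (d - 2) + 360) * n ^ 45 := by
            rw [e]; exact Nat.mul_le_mul_left _ h24
        _ = n ^ (180 * (d - 2)) * n ^ 405 := by rw [pow_add]; ring
        _ ≤ _ := Nat.mul_le_mul_right _ hmain
  refine (Nat.pow_le_pow_iff_left (n := 5) (by norm_num)).1 ?_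
  have hX' : X ^ 36 ≤ (q ^ d * q ^ (d * d) * 2 ^ c) ^ 36 := Nat.pow_le_pow_left hX _
  calc (X ^ 36 * 24 ^ 12) ^ 5 ≤ ((q ^ d * q ^ (d * d) * 2 ^ c) ^ 36 * 24 ^ 12) ^ 5 :=
        Nat.pow_le_pow_left (Nat.mul_le_mul_right _ hX') _
    _ = (q ^ d) ^ 180 * (q ^ (d * (180 * d)) * 24 ^ 60) * 2 ^ (180 * c) := by
        have e1 : q ^ (d * (180 * d)) = (q ^ (d * d)) ^ 180 := by rw [← pow_mul]; congr 1; ring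
        have e2 : 2 ^ (180 * c) = (2 ^ c) ^ 180 := by rw [← pow_mul]; congr 1; ring
        rw [e1, e2]
        generalize q ^ d = u
        generalize q ^ (d * d) = v
        generalize 2 ^ c = w
        rw [show (24 : ℕ) ^ 60 = (24 ^ 12) ^ 5 by rw [← pow_mul]]
        generalize 24 ^ 12 = z
        ring
    _ ≤ (q ^ d) ^ 180 * (2 ^ (16 * q ^ d) * (q ^ d) ^ 405) * 2 ^ (84 * q ^ d) :=
        Nat.mul_le_mul (Nat.mul_le_mul_left _ (h5 _ rfl))
          (Nat.pow_le_pow_right (by norm_num) (by omega))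
    _ = _ := by
        generalize q ^ d = n
        have e1 : 2 ^ (84 * n) = (2 ^ n) ^ 84 := by rw [← pow_mul]; congr 1; ring
        have e2 : 2 ^ (16 * n) = (2 ^ n) ^ 16 := by rw [← pow_mul]; congr 1; ring
        have e3 : 2 ^ (20 * n) = (2 ^ n) ^ 20 := by rw [← pow_mul]; congr 1; ring
        rw [e1, e2, e3]
        generalize 2 ^ n = w
        ring

theorem bound_of_le_two_pow_mul {n X a m k : ℕ} (hX : X ≤ 2 ^ a * m)
    (hm : m ^ 36 * 24 ^ 12 ≤ 2 ^ k * n ^ 117) (hk : 36 * a + k ≤ 20 * n) :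
    X ^ 36 * 24 ^ 12 ≤ 2 ^ (20 * n) * n ^ 117 :=
  calc X ^ 36 * 24 ^ 12 ≤ (2 ^ a * m) ^ 36 * 24 ^ 12 :=
        Nat.mul_le_mul_right _ (Nat.pow_le_pow_left hX _)
    _ = 2 ^ (36 * a) * (m ^ 36 * 24 ^ 12) := by
        rw [mul_pow, ← pow_mul, mul_comm a, mul_assoc]
    _ ≤ 2 ^ (36 * a) * (2 ^ k * n ^ 117) := Nat.mul_le_mul_left _ hm
    _ = 2 ^ (36 * a + k) * n ^ 117 := by rw [pow_add, mul_assoc]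
    _ ≤ _ := Nat.mul_le_mul_right _ (Nat.pow_le_pow_right (by norm_num) hk)

theorem bound_of_prime_three {d X : ℕ} (hd : 5 ≤ d)
    (hX : X ≤ 3 * (3 ^ d) ^ 2 * 2 ^ (15 * 3 ^ (d - 3)) +
      3 ^ d * 3 ^ (d * d) * 2 ^ (11 * 3 ^ (d - 3))) :
    X ^ 36 * 24 ^ 12 ≤ 2 ^ (20 * 3 ^ d) * (3 ^ d) ^ 117 := by
  have hn : 3 ^ d = 27 * 3 ^ (d - 3) := by
    obtain ⟨k, rfl⟩ : ∃ k, d = k + 3 := ⟨d - 3, by omega⟩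
    rw [Nat.add_sub_cancel, pow_add]
    ring
  have h243 : 3 ^ 5 ≤ 3 ^ d := Nat.pow_le_pow_right (by norm_num) hd
  have hexp : 8 * (d * (d - 1)) ≤ 20 * 3 ^ (d - 3) := by
    clear * - hd
    induction d, hd using Nat.le_induction with
    | base => norm_num
    | succ d hd ih =>
      obtain ⟨k, rfl⟩ : ∃ k, d = k + 5 := ⟨d - 5, by omega⟩
      rw [show k + 5 + 1 - 1 = k + 5 by omega, show k + 5 + 1 - 3 = k + 5 - 3 + 1 by omega,
        pow_succ]
      rw [show k + 5 - 1 = k + 4 by omega] at ih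
      nlinarith
  have hpow : 3 ^ (d * (d - 1)) ≤ 2 ^ (4 * 3 ^ (d - 3)) := by
    refine (Nat.pow_le_pow_iff_left (n := 5) (by norm_num)).1 ?_
    calc (3 ^ (d * (d - 1))) ^ 5 = (3 ^ 5) ^ (d * (d - 1)) := by
          rw [← pow_mul, ← pow_mul, mul_comm]
      _ ≤ (2 ^ 8) ^ (d * (d - 1)) := Nat.pow_le_pow_left (by norm_num) _
      _ = 2 ^ (8 * (d * (d - 1))) := by rw [← pow_mul]
      _ ≤ 2 ^ (20 * 3 ^ (d - 3)) := Nat.pow_le_pow_right (by norm_num) hexp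
      _ = _ := by rw [← pow_mul]; congr 1; ring
  refine bound_of_le_two_pow_mul (a := 15 * 3 ^ (d - 3)) (m := 4 * (3 ^ d) ^ 2) (k := 0) ?_ ?_ ?_
  · refine hX.trans ?_
    have h2 : 3 ^ d * 3 ^ (d * d) * 2 ^ (11 * 3 ^ (d - 3)) ≤
        (3 ^ d) ^ 2 * 2 ^ (15 * 3 ^ (d - 3)) := by
      calc 3 ^ d * 3 ^ (d * d) * 2 ^ (11 * 3 ^ (d - 3))
          = (3 ^ d) ^ 2 * 3 ^ (d * (d - 1)) * 2 ^ (11 * 3 ^ (d - 3)) := by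
            congr 1
            rw [← pow_add, ← pow_mul, ← pow_add]
            congr 1
            obtain ⟨k, rfl⟩ : ∃ k, d = k + 1 := ⟨d - 1, by omega⟩
            rw [Nat.add_sub_cancel]
            ring
        _ ≤ (3 ^ d) ^ 2 * 2 ^ (4 * 3 ^ (d - 3)) * 2 ^ (11 * 3 ^ (d - 3)) :=
            Nat.mul_le_mul_right _ (Nat.mul_le_mul_left _ hpow)
        _ = _ := by rw [mul_assoc, ← pow_add]; congr 2; ring
    linarith
  · generalize 3 ^ d = n at *
    rw [mul_pow, ← pow_mul, pow_zero, one_mul]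
    calc 4 ^ 36 * n ^ (2 * 36) * 24 ^ 12 = n ^ 72 * (4 ^ 36 * 24 ^ 12) := by ring
      _ ≤ n ^ 72 * n ^ 45 := by
          refine Nat.mul_le_mul_left _ ?_
          calc 4 ^ 36 * 24 ^ 12 ≤ (3 ^ 5) ^ 45 := by norm_num
            _ ≤ _ := Nat.pow_le_pow_left h243 _
      _ = n ^ 117 := by rw [← pow_add]
  · rw [hn]; omega

theorem bound_of_le_two_pow {d X K : ℕ} (hX : X ≤ 2 ^ K) (hK : 36 * K + 56 ≤ 20 * 2 ^ d + 117 * d) :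
    X ^ 36 * 24 ^ 12 ≤ 2 ^ (20 * 2 ^ d) * (2 ^ d) ^ 117 :=
  calc X ^ 36 * 24 ^ 12 ≤ (2 ^ K) ^ 36 * 2 ^ 56 :=
        Nat.mul_le_mul (Nat.pow_le_pow_left hX _) (by norm_num)
    _ = 2 ^ (36 * K + 56) := by rw [← pow_mul, ← pow_add, mul_comm K]
    _ ≤ 2 ^ (20 * 2 ^ d + 117 * d) := Nat.pow_le_pow_right (by norm_num) hK
    _ = _ := by rw [pow_add, ← pow_mul, mul_comm 117]

theorem bound_of_prime_two {d h X : ℕ} (hd : 4 ≤ d) (hh : d ≤ 10 → h ≤ 2 ^ (d * d / 2 + 1))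
    (hh' : h ≤ 2 ^ (d * d))
    (hX : X ≤ 4 * h * 2 ^ (4 * 2 ^ (d - 3)) + 2 ^ d * h * 2 ^ (3 * 2 ^ (d - 3))) :
    X ^ 36 * 24 ^ 12 ≤ 2 ^ (20 * 2 ^ d) * (2 ^ d) ^ 117 := by
  have key : ∀ b, h ≤ 2 ^ b →
      X ≤ 2 ^ (b + 2 + 4 * 2 ^ (d - 3)) + 2 ^ (b + d + 3 * 2 ^ (d - 3)) := by
    intro b hb
    refine hX.trans (Nat.add_le_add ?_ ?_)
    · calc 4 * h * 2 ^ (4 * 2 ^ (d - 3)) ≤ 4 * 2 ^ b * 2 ^ (4 * 2 ^ (d - 3)) :=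
            Nat.mul_le_mul_right _ (Nat.mul_le_mul_left _ hb)
        _ = _ := by rw [pow_add, pow_add]; ring
    · calc 2 ^ d * h * 2 ^ (3 * 2 ^ (d - 3)) ≤ 2 ^ d * 2 ^ b * 2 ^ (3 * 2 ^ (d - 3)) :=
            Nat.mul_le_mul_right _ (Nat.mul_le_mul_left _ hb)
        _ = _ := by rw [pow_add, pow_add, mul_comm (2 ^ d)]
  have key' : ∀ b K, h ≤ 2 ^ b → b + 3 + 4 * 2 ^ (d - 3) ≤ K → b + d + 1 + 3 * 2 ^ (d - 3) ≤ K →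
      36 * K + 56 ≤ 20 * 2 ^ d + 117 * d →
      X ^ 36 * 24 ^ 12 ≤ 2 ^ (20 * 2 ^ d) * (2 ^ d) ^ 117 := by
    intro b K hb h1 h2 hK
    refine bound_of_le_two_pow ?_ hK
    obtain ⟨K, rfl⟩ : ∃ k, K = k + 1 := ⟨K - 1, by omega⟩
    rw [pow_succ, mul_two]
    exact (key b hb).trans (Nat.add_le_add (Nat.pow_le_pow_right (by norm_num) (by omega))
      (Nat.pow_le_pow_right (by norm_num) (by omega)))
  rcases Nat.lt_or_ge 10 d with h10 | h10
  · have hsq : 36 * (d * d) ≤ 2 * 2 ^ d + 81 * d - 164 := by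
      clear * - h10
      have : 36 * (d * d) + 164 ≤ 2 * 2 ^ d + 81 * d := by
        induction d, (show 11 ≤ d from h10) using Nat.le_induction with
        | base => norm_num
        | succ d hd ih =>
          have h1 : 36 * d ≤ 2 ^ d := by
            clear * - hd
            induction d, hd using Nat.le_induction with
            | base => norm_num
            | succ d hd ih => rw [pow_succ]; omega
          have ih' := ih hd
          rw [pow_succ]
          nlinarith
      omega
    have hn : 2 ^ d = 8 * 2 ^ (d - 3) := by
      obtain ⟨k, rfl⟩ : ∃ k, d = k + 3 := ⟨d - 3, by omega⟩
      rw [Nat.add_sub_cancel, pow_add]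
      ring
    have h256 : 2 ^ 8 ≤ 2 ^ (d - 3) := Nat.pow_le_pow_right (by norm_num) (by omega)
    exact key' (d * d) (d * d + d + 3 + 4 * 2 ^ (d - 3)) hh' (by omega) (by omega) (by omega)
  · have hb := hh h10
    by_cases h6 : d = 6
    · subst h6
      refine bound_of_le_two_pow_mul (a := 30) (m := 17 * 2 ^ 19) (k := 200) ?_ (by norm_num)
        (by norm_num)
      refine (key _ hb).trans ?_
      norm_num
    by_cases h4 : d = 4
    · subst h4
      refine bound_of_le_two_pow (K := 20) ((key _ hb).trans ?_) (by norm_num)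
      norm_num
    refine key' _ (d * d / 2 + 4 + 4 * 2 ^ (d - 3)) hb (by omega) ?_ ?_
    · interval_cases d <;> first | exact absurd rfl h4 | exact absurd rfl h6 | norm_num
    · interval_cases d <;> first | exact absurd rfl h4 | exact absurd rfl h6 | norm_num

section Affine

variable {Ω V : Type*} [Finite Ω] {G : Subgroup (Equiv.Perm Ω)} {q : ℕ} [Fact q.Prime]
  [AddCommGroup V] [Finite V] [Module (ZMod q) V] (e : V ≃ Ω) (ρ : G →* (V ≃ₗ[ZMod q] V))
  (hρ : ∀ g v, e.symm (g • e v) = ρ g v + e.symm (g • e 0))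

include hρ

theorem exists_card_invariant_sets_eq {g : G} (hg : ∃ p : ℕ, p.Prime ∧ p ≠ 2 ∧ orderOf g = p) :
    ∃ r c m, r.Prime ∧ 3 ≤ r ∧ Nat.card {Γ : Set Ω // g • Γ = Γ} = 2 ^ c ∧
      c = Nat.card {x : Ω // g • x = x} + m ∧
      r * m + Nat.card {x : Ω // g • x = x} = q ^ Module.finrank (ZMod q) V ∧
      (Nat.card {x : Ω // g • x = x} = 0 ∨
        (Module.finrank (ZMod q) (LinearMap.ker ((ρ g).toLinearMap - LinearMap.id)) <
          Module.finrank (ZMod q) V ∧ Nat.card {x : Ω // g • x = x} =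
          q ^ Module.finrank (ZMod q) (LinearMap.ker ((ρ g).toLinearMap - LinearMap.id)))) := by
  obtain ⟨r, hr, hr2, hgr⟩ := hg
  obtain ⟨c, hw, hc⟩ := card_invariant_sets_of_prime_orderOf hr g hgr
  have hr3 : 3 ≤ r := by have := hr.two_le; omega
  have hn : Nat.card Ω = q ^ Module.finrank (ZMod q) V := by
    rw [← Nat.card_congr e, Module.natCard_eq_pow_finrank (K := ZMod q), Nat.card_zmod]
  have hf : Nat.card {x : Ω // g • x = x} ≤ Nat.card Ω := Finite.card_subtype_le _
  have hg1 : g ≠ 1 := by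
    rintro rfl
    rw [orderOf_one] at hgr
    exact hr.one_lt.ne hgr
  have hlt := finrank_ker_lt e ρ hρ hg1
  have hcard := card_fixedBy_eq_zero_or e ρ hρ g
  rw [hn] at hc hf
  set f := Nat.card {x : Ω // g • x = x}
  have hcf : f ≤ c := by
    obtain ⟨s, rfl⟩ : ∃ s, r = s + 1 := ⟨r - 1, by omega⟩
    rw [Nat.add_sub_cancel] at hc
    nlinarith
  obtain ⟨m, rfl⟩ := Nat.exists_eq_add_of_le hcf
  refine ⟨r, f + m, m, hr, hr3, hw, rfl, ?_, ?_⟩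
  · obtain ⟨s, rfl⟩ : ∃ s, r = s + 1 := ⟨r - 1, by omega⟩
    rw [Nat.add_sub_cancel] at hc
    nlinarith
  · rcases hcard with h | h
    · exact Or.inl h
    · exact Or.inr ⟨hlt (by rw [h]; exact pow_ne_zero _ (Fact.out : q.Prime).ne_zero), h⟩

theorem sum_card_invariant_sets_bound_of_five_le (hq : 5 ≤ q)
    (hd : 1 ≤ Module.finrank (ZMod q) V) (T : Finset G)
    (hT : ∀ g ∈ T, ∃ p : ℕ, p.Prime ∧ p ≠ 2 ∧ orderOf g = p) :
    (∑ g ∈ T, Nat.card {Γ : Set Ω // g • Γ = Γ}) ^ 36 * 24 ^ 12 ≤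
      2 ^ (20 * q ^ Module.finrank (ZMod q) V) * (q ^ Module.finrank (ZMod q) V) ^ 117 := by
  have hn : Nat.card Ω = q ^ Module.finrank (ZMod q) V := by
    rw [← Nat.card_congr e, Module.natCard_eq_pow_finrank (K := ZMod q), Nat.card_zmod]
  refine bound_of_five_le_prime (c := 7 * q ^ Module.finrank (ZMod q) V / 15) hq hd (by omega) ?_
  have hw : ∀ g ∈ T, Nat.card {Γ : Set Ω // g • Γ = Γ} ≤
      2 ^ (7 * q ^ Module.finrank (ZMod q) V / 15) := by
    intro g hg
    obtain ⟨r, c, m, hr, hr3, hw, hc, hm, hf⟩ := exists_card_invariant_sets_eq e ρ hρ (hT g hg)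
    rw [hw]
    refine Nat.pow_le_pow_right (by norm_num) ?_
    have h3 : 3 * m ≤ r * m := Nat.mul_le_mul_right _ hr3
    have h5 : 5 * Nat.card {x : Ω // g • x = x} ≤ q ^ Module.finrank (ZMod q) V := by
      rcases hf with hf | ⟨hlt, hf⟩
      · omega
      · rw [hf]
        calc _ ≤ q * q ^ _ := Nat.mul_le_mul_right _ hq
          _ = q ^ (_ + 1) := (pow_succ' _ _).symm
          _ ≤ _ := Nat.pow_le_pow_right (by omega) hlt
    omega
  have hTc := card_le_mul_of_linear_part e ρ hρ T Set.univ fun _ _ => Set.mem_univ _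
  rw [Nat.card_coe_set_eq, Set.ncard_univ, hn] at hTc
  calc _ ≤ T.card * 2 ^ (7 * q ^ Module.finrank (ZMod q) V / 15) := by
        rw [← smul_eq_mul]; exact Finset.sum_le_card_nsmul _ _ _ hw
    _ ≤ _ := Nat.mul_le_mul_right _ (hTc.trans (by
        rw [mul_comm]; exact Nat.mul_le_mul_left _ card_linearEquiv_le_pow))

end Affine

theorem sum_le_add_of_forall_le {ι : Type*} (T : Finset ι) (P : ι → Prop) [DecidablePred P]
    {w : ι → ℕ} {A B a b : ℕ} (hA : (T.filter P).card ≤ A)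
    (hB : (T.filter fun i => ¬ P i).card ≤ B) (ha : ∀ i ∈ T, P i → w i ≤ a)
    (hb : ∀ i ∈ T, ¬ P i → w i ≤ b) : ∑ i ∈ T, w i ≤ A * a + B * b := by
  rw [← Finset.sum_filter_add_sum_filter_not T P]
  refine Nat.add_le_add ?_ ?_
  · refine (Finset.sum_le_card_nsmul _ _ a fun i hi => ?_).trans
      (by rw [smul_eq_mul]; exact Nat.mul_le_mul_right _ hA)
    rw [Finset.mem_filter] at hi
    exact ha i hi.1 hi.2
  · refine (Finset.sum_le_card_nsmul _ _ b fun i hi => ?_).trans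
      (by rw [smul_eq_mul]; exact Nat.mul_le_mul_right _ hB)
    rw [Finset.mem_filter] at hi
    exact hb i hi.1 hi.2

theorem sum_bound_of_prime_three {ι : Type*} (T : Finset ι) (w f : ι → ℕ) {d N : ℕ} (hd : 1 ≤ d)
    (hw : ∀ g ∈ T, ∃ c, w g = 2 ^ c ∧ 3 * c ≤ 3 ^ d + 2 * f g ∧
      (3 * f g = 3 ^ d ∨ 9 * f g ≤ 3 ^ d) ∧ (f g = 0 ∨ ∃ i, f g = 3 ^ i))
    (hA : (T.filter fun g => 3 * f g = 3 ^ d).card ≤ 3 * (3 ^ d) ^ 2)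
    (hB : ∀ T' ⊆ T, ∀ s, (∀ g ∈ T', s ≤ f g) → T'.card * s ≤ N * 3 ^ d)
    (hT : ∀ T' ⊆ T, T'.card ≤ N * 3 ^ d)
    (hN : N ≤ ∏ i : Fin d, (3 ^ d - 3 ^ (i : ℕ))) (hN' : N ≤ 3 ^ (d * d)) :
    (∑ g ∈ T, w g) ^ 36 * 24 ^ 12 ≤ 2 ^ (20 * 3 ^ d) * (3 ^ d) ^ 117 := by
  classical
  have hpow : ∀ k, (∀ g ∈ T, ∀ c, w g = 2 ^ c → 3 * c ≤ 3 ^ d + 2 * f g → c ≤ k) →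
      ∀ g ∈ T, w g ≤ 2 ^ k := by
    intro k hk g hg
    obtain ⟨c, hc, h3, -⟩ := hw g hg
    rw [hc]
    exact Nat.pow_le_pow_right (by norm_num) (hk g hg c hc h3)
  have hsum : ∀ T' ⊆ T, ∀ k, (∀ g ∈ T', w g ≤ 2 ^ k) → ∑ g ∈ T', w g ≤ N * 3 ^ d * 2 ^ k := by
    intro T' hT' k hk
    refine (Finset.sum_le_card_nsmul _ _ _ hk).trans ?_
    rw [smul_eq_mul]
    exact Nat.mul_le_mul_right _ (hT T' hT')
  have hf : ∀ g ∈ T, 3 * f g ≤ 3 ^ d := by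
    intro g hg
    obtain ⟨c, -, -, h | h, -⟩ := hw g hg <;> omega
  have hle : ∀ k k', 5 * 3 ^ d < 9 * k + 9 → 11 * 3 ^ d < 27 * k' + 27 →
      (∀ g ∈ T, 3 * f g = 3 ^ d → w g ≤ 2 ^ k) ∧ (∀ g ∈ T, ¬ 3 * f g = 3 ^ d → w g ≤ 2 ^ k') := by
    intro k k' hk hk'
    constructor
    all_goals
      intro g hg hP
      obtain ⟨c, hc, h3, h, -⟩ := hw g hg
      rw [hc]
      exact Nat.pow_le_pow_right (by norm_num) (by omega)
  rcases Nat.lt_or_ge d 5 with hd5 | hd5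
  · interval_cases d
    · norm_num [Fin.prod_univ_succ] at hN
      refine bound_of_le_two_pow_mul (a := 1) (m := 6) (k := 24) ?_ (by norm_num) (by norm_num)
      refine (hsum T subset_rfl 1 (hpow 1 fun g hg c _ h3 => ?_)).trans (by omega)
      have := hf g hg
      omega
    · norm_num [Fin.prod_univ_succ] at hN
      refine bound_of_le_two_pow_mul (a := 5) (m := 432) (k := 0) ?_ (by norm_num) (by norm_num)
      refine (hsum T subset_rfl 5 (hpow 5 fun g hg c _ h3 => ?_)).trans (by omega)
      have := hf g hg
      omega
    · norm_num [Fin.prod_univ_succ] at hN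
      refine bound_of_le_two_pow_mul (a := 9) (m := 847584) (k := 216) ?_ (by norm_num)
        (by norm_num)
      obtain ⟨h1, h2⟩ := hle 15 11 (by norm_num) (by norm_num)
      rw [← Finset.sum_filter_add_sum_filter_not T fun g => 3 * f g = 3 ^ 3]
      set T' := T.filter fun g => ¬ 3 * f g = 3 ^ 3
      have hT' : T' ⊆ T := Finset.filter_subset _ _
      have hA' : ∑ g ∈ T.filter (fun g => 3 * f g = 3 ^ 3), w g ≤ _ :=
        (Finset.sum_le_card_nsmul _ w _ fun g hg =>
          h1 g (Finset.mem_filter.1 hg).1 (Finset.mem_filter.1 hg).2)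
      rw [smul_eq_mul] at hA'
      have h3 : (T'.filter fun g => f g = 3).card * 3 ≤ N * 3 ^ 3 :=
        hB _ ((Finset.filter_subset _ _).trans hT') 3 fun g hg => (Finset.mem_filter.1 hg).2.ge
      have hB' := sum_le_add_of_forall_le T' (fun g => f g = 3) (w := w) (A := 9 * N)
        (B := 27 * N) (a := 2 ^ 11) (b := 2 ^ 9) (by omega)
        ((hT _ ((Finset.filter_subset _ _).trans hT')).trans (by omega))
        (fun g hg _ => h2 g (hT' hg) (Finset.mem_filter.1 hg).2)
        (fun g hg hg3 => by
          have hP := (Finset.mem_filter.1 hg).2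
          obtain ⟨c, hc, h, h', h0⟩ := hw g (hT' hg)
          rw [hc]
          refine Nat.pow_le_pow_right (by norm_num) ?_
          have hg2 : f g ≠ 2 := by
            intro h2
            rcases h0 with h0 | ⟨i, hi⟩
            · omega
            · rw [h2] at hi
              rcases i with _ | i
              · simp at hi
              · rw [pow_succ] at hi
                omega
          omega)
      omega
    · norm_num [Fin.prod_univ_succ] at hN
      refine bound_of_le_two_pow_mul (a := 42) (m := 3995649) (k := 108) ?_ (by norm_num)
        (by norm_num)
      obtain ⟨h1, h2⟩ := hle 45 33 (by norm_num) (by norm_num)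
      refine (sum_le_add_of_forall_le T _ hA (hT _ (Finset.filter_subset _ _)) h1 h2).trans ?_
      omega
  · refine bound_of_prime_three hd5 ?_
    have h27 : 3 ^ d = 27 * 3 ^ (d - 3) := by
      rw [← Nat.sub_add_cancel (show 3 ≤ d by omega), pow_add, Nat.add_sub_cancel]
      ring
    obtain ⟨h1, h2⟩ := hle (15 * 3 ^ (d - 3)) (11 * 3 ^ (d - 3)) (by omega) (by omega)
    refine (sum_le_add_of_forall_le T _ hA (hT _ (Finset.filter_subset _ _)) h1 h2).trans ?_
    rw [mul_comm N]
    gcongr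

section AffineThree

variable {Ω V : Type*} [Finite Ω] {G : Subgroup (Equiv.Perm Ω)}
  [AddCommGroup V] [Finite V] [Module (ZMod 3) V] (e : V ≃ Ω) (ρ : G →* (V ≃ₗ[ZMod 3] V))
  (hρ : ∀ g v, e.symm (g • e v) = ρ g v + e.symm (g • e 0))

include hρ

theorem card_invariant_sets_prime_three {g : G}
    (hg : ∃ p : ℕ, p.Prime ∧ p ≠ 2 ∧ orderOf g = p) :
    ∃ c, Nat.card {Γ : Set Ω // g • Γ = Γ} = 2 ^ c ∧
      3 * c ≤ 3 ^ Module.finrank (ZMod 3) V + 2 * Nat.card {x : Ω // g • x = x} ∧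
      ((3 * Nat.card {x : Ω // g • x = x} = 3 ^ Module.finrank (ZMod 3) V ∧
        Module.finrank (ZMod 3) V ≤
          Module.finrank (ZMod 3) (LinearMap.ker ((ρ g).toLinearMap - LinearMap.id)) + 1) ∨
      9 * Nat.card {x : Ω // g • x = x} ≤ 3 ^ Module.finrank (ZMod 3) V) := by
  obtain ⟨r, c, m, hr, hr3, hw, hc, hm, hf⟩ := exists_card_invariant_sets_eq e ρ hρ hg
  have h3 : 3 * m ≤ r * m := Nat.mul_le_mul_right _ hr3
  refine ⟨c, hw, by omega, ?_⟩
  rcases hf with hf | ⟨hlt, hf⟩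
  · right; omega
  · rw [hf]
    rcases Nat.lt_or_ge (Module.finrank (ZMod 3) (LinearMap.ker
      ((ρ g).toLinearMap - LinearMap.id)) + 1) (Module.finrank (ZMod 3) V) with h | h
    · right
      calc _ = 3 ^ (_ + 2) := by rw [pow_add, mul_comm]; norm_num
        _ ≤ _ := Nat.pow_le_pow_right (by norm_num) h
    · left
      refine ⟨?_, h⟩
      rw [← pow_succ']
      congr 1
      omega

theorem sum_card_invariant_sets_bound_of_prime_three
    (hd : 1 ≤ Module.finrank (ZMod 3) V) (T : Finset G)
    (hT : ∀ g ∈ T, ∃ p : ℕ, p.Prime ∧ p ≠ 2 ∧ orderOf g = p) :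
    (∑ g ∈ T, Nat.card {Γ : Set Ω // g • Γ = Γ}) ^ 36 * 24 ^ 12 ≤
      2 ^ (20 * 3 ^ Module.finrank (ZMod 3) V) * (3 ^ Module.finrank (ZMod 3) V) ^ 117 := by
  classical
  have hV : Nat.card V = 3 ^ Module.finrank (ZMod 3) V := by
    rw [Module.natCard_eq_pow_finrank (K := ZMod 3), Nat.card_zmod]
  have hn : Nat.card Ω = 3 ^ Module.finrank (ZMod 3) V := by rw [← Nat.card_congr e, hV]
  have key := fun g hg => card_invariant_sets_prime_three e ρ hρ (hT g hg)
  have hcard : ∀ T' : Finset G, T'.card ≤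
      Nat.card (V ≃ₗ[ZMod 3] V) * 3 ^ Module.finrank (ZMod 3) V := by
    intro T'
    have := card_le_mul_of_linear_part e ρ hρ T' Set.univ fun _ _ => Set.mem_univ _
    rwa [Nat.card_coe_set_eq, Set.ncard_univ, hn] at this
  let P : G → Prop := fun g =>
    3 * Nat.card {x : Ω // g • x = x} = 3 ^ Module.finrank (ZMod 3) V
  have hmem : ∀ (Q : G → Prop) [DecidablePred Q] (g : G), g ∈ T.filter Q → g ∈ T ∧ Q g :=
    fun Q _ g => Finset.mem_filter.1
  have hPc : (T.filter P).card ≤ 3 * (3 ^ Module.finrank (ZMod 3) V) ^ 2 := by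
    have h := card_mul_le_of_fixed_points e ρ hρ (T.filter P) (3 ^ (Module.finrank (ZMod 3) V - 1))
      (fun g hg => by
        have h1 : 3 * _ = _ := (hmem P g hg).2
        rw [← Nat.sub_add_cancel hd, pow_succ'] at h1
        omega) {L : V ≃ₗ[ZMod 3] V | Module.finrank (ZMod 3) V ≤
          Module.finrank (ZMod 3) (LinearMap.ker (L.toLinearMap - LinearMap.id)) + 1}
      (fun g hg => by
        obtain ⟨hgT, hgP⟩ := hmem P g hg
        obtain ⟨c, -, -, h | h⟩ := key g hgT
        · exact h.2
        · have hP : 3 * _ = _ := hgP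
          have : 0 < 3 ^ Module.finrank (ZMod 3) V := by positivity
          omega)
    have h2 := h.trans (Nat.mul_le_mul_right _ card_transvections_le)
    rw [hV, hn] at h2
    have h3 : 3 ^ Module.finrank (ZMod 3) V = 3 * 3 ^ (Module.finrank (ZMod 3) V - 1) := by
      rw [← pow_succ', Nat.sub_add_cancel hd]
    have hpos : 0 < 3 ^ (Module.finrank (ZMod 3) V - 1) := by positivity
    refine Nat.le_of_mul_le_mul_right (h2.trans (le_of_eq ?_)) hpos
    rw [h3]; ring
  have hB : ∀ T' ⊆ T, ∀ s, (∀ g ∈ T', s ≤ Nat.card {x : Ω // g • x = x}) →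
      T'.card * s ≤ Nat.card (V ≃ₗ[ZMod 3] V) * 3 ^ Module.finrank (ZMod 3) V := by
    intro T' _ s hs
    have := card_mul_le_of_fixed_points e ρ hρ T' s hs Set.univ fun _ _ => Set.mem_univ _
    rwa [Nat.card_coe_set_eq, Set.ncard_univ, hn] at this
  refine sum_bound_of_prime_three T _ (fun g => Nat.card {x : Ω // g • x = x}) hd ?_ hPc hB
    (fun T' _ => hcard T') card_linearEquiv_le_prod card_linearEquiv_le_pow
  intro g hg
  obtain ⟨c, hw, hc, h⟩ := key g hg
  refine ⟨c, hw, hc, h.imp_left And.left, ?_⟩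
  exact (card_fixedBy_eq_zero_or e ρ hρ g).imp_right fun h => ⟨_, h⟩

end AffineThree

theorem fixed_points_cases_of_prime_two {r m f c d : ℕ} (hr : r.Prime) (hr3 : 3 ≤ r)
    (h : r * m + f = 2 ^ d) (hf : f = 0 ∨ ∃ i < d, f = 2 ^ i) (hc : c = f + m) :
    (4 * f = 2 ^ d ∧ 2 * c = 2 ^ d) ∨ 8 * c ≤ 3 * 2 ^ d := by
  have h3 : 3 * m ≤ r * m := Nat.mul_le_mul_right _ hr3
  rcases hf with hf | ⟨i, hi, rfl⟩
  · right; omega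
  obtain ⟨j, rfl⟩ := Nat.exists_eq_add_of_lt hi
  have hdvd : r ∣ 2 ^ (j + 1) - 1 := by
    have h1 : r ∣ 2 ^ i * (2 ^ (j + 1) - 1) := by
      refine ⟨m, ?_⟩
      rw [Nat.mul_sub, ← pow_add, ← add_assoc, mul_one]
      omega
    refine (hr.dvd_mul.1 h1).resolve_left fun h2 => ?_
    have := Nat.le_of_dvd (by norm_num) (hr.dvd_of_dvd_pow h2)
    omega
  rw [add_assoc, pow_add] at h
  rw [add_assoc, pow_add]
  rcases j with _ | _ | _ | j
  · have := Nat.le_of_dvd (by norm_num) hdvd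
    norm_num at this
    omega
  · left
    have : r = 3 := by
      have := Nat.le_of_dvd (by norm_num) hdvd
      norm_num at this
      omega
    subst this
    norm_num at h ⊢
    omega
  · right
    have : r = 7 := by
      norm_num at hdvd
      exact (Nat.prime_dvd_prime_iff_eq hr (by norm_num)).1 hdvd
    subst this
    norm_num at h ⊢
    omega
  · right
    have hp : 2 ^ i * 2 ^ (j + 1 + 1 + 1 + 1) = 16 * (2 ^ i * 2 ^ j) := by ring
    have : 2 ^ i ≤ 2 ^ i * 2 ^ j := Nat.le_mul_of_pos_right _ (by positivity)
    have hp' : 2 ^ (j + 1 + 1 + 1 + 1) = 16 * 2 ^ j := by ring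
    omega

section AffineTwo

variable {Ω V : Type*} [Finite Ω] {G : Subgroup (Equiv.Perm Ω)}
  [AddCommGroup V] [Finite V] [Module (ZMod 2) V] (e : V ≃ Ω) (ρ : G →* (V ≃ₗ[ZMod 2] V))
  (hρ : ∀ g v, e.symm (g • e v) = ρ g v + e.symm (g • e 0))

include hρ

theorem sum_card_invariant_sets_bound_of_prime_two (hG : Group.IsSolvable G)
    (hirr : ∀ W : Submodule (ZMod 2) V, (∀ g, ∀ w ∈ W, ρ g w ∈ W) → W = ⊥ ∨ W = ⊤)
    (hd : 1 ≤ Module.finrank (ZMod 2) V) (T : Finset G)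
    (hT : ∀ g ∈ T, ∃ p : ℕ, p.Prime ∧ p ≠ 2 ∧ orderOf g = p) :
    (∑ g ∈ T, Nat.card {Γ : Set Ω // g • Γ = Γ}) ^ 36 * 24 ^ 12 ≤
      2 ^ (20 * 2 ^ Module.finrank (ZMod 2) V) * (2 ^ Module.finrank (ZMod 2) V) ^ 117 := by
  classical
  have hn : Nat.card Ω = 2 ^ Module.finrank (ZMod 2) V := by
    rw [← Nat.card_congr e, Module.natCard_eq_pow_finrank (K := ZMod 2), Nat.card_zmod]
  have : Finite (V ≃ₗ[ZMod 2] V) := Finite.of_injective (fun f => (f : V → V))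
    DFunLike.coe_injective
  have hH := card_bound_of_irreducible_solvable ρ.range
    (Group.isSolvable_of_surjective ρ.rangeRestrict_surjective) fun W hW =>
    hirr W fun g w hw => hW (ρ g) ⟨g, rfl⟩ w hw
  have hle : Nat.card ρ.range ≤ Nat.card (V ≃ₗ[ZMod 2] V) := Finite.card_subtype_le _
  have hprod := hle.trans card_linearEquiv_le_prod
  have hsq := hle.trans card_linearEquiv_le_pow
  have hcard : ∀ T' : Finset G, T'.card ≤
      Nat.card ρ.range * 2 ^ Module.finrank (ZMod 2) V := by
    intro T'
    have := card_le_mul_of_linear_part e ρ hρ T' ρ.range fun g _ => ⟨g, rfl⟩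
    rwa [hn] at this
  have hcard' : ∀ T' : Finset G, ∀ s, (∀ g ∈ T', s ≤ Nat.card {x : Ω // g • x = x}) →
      T'.card * s ≤ Nat.card ρ.range * 2 ^ Module.finrank (ZMod 2) V := by
    intro T' s hs
    have := card_mul_le_of_fixed_points e ρ hρ T' s hs ρ.range fun g _ => ⟨g, rfl⟩
    rwa [hn] at this
  have key : ∀ g ∈ T, ∃ c, Nat.card {Γ : Set Ω // g • Γ = Γ} = 2 ^ c ∧
      ((4 * Nat.card {x : Ω // g • x = x} = 2 ^ Module.finrank (ZMod 2) V ∧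
        2 * c = 2 ^ Module.finrank (ZMod 2) V) ∨
      8 * c ≤ 3 * 2 ^ Module.finrank (ZMod 2) V) := by
    intro g hg
    obtain ⟨r, c, m, hr, hr3, hw, hc, hm, hf⟩ := exists_card_invariant_sets_eq e ρ hρ (hT g hg)
    exact ⟨c, hw, fixed_points_cases_of_prime_two hr hr3 hm
      (hf.imp_right fun h => ⟨_, h⟩) hc⟩
  generalize Nat.card ρ.range = h at *
  generalize Module.finrank (ZMod 2) V = d at *
  have hpow : ∀ k, 2 ^ d ≤ 2 * k → (∀ g ∈ T, Nat.card {Γ : Set Ω // g • Γ = Γ} ≤ 2 ^ k) := by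
    intro k hk g hg
    obtain ⟨c, hw, hc⟩ := key g hg
    rw [hw]
    exact Nat.pow_le_pow_right (by norm_num) (by omega)
  have hsum : ∀ k, (∀ g ∈ T, Nat.card {Γ : Set Ω // g • Γ = Γ} ≤ 2 ^ k) →
      ∑ g ∈ T, Nat.card {Γ : Set Ω // g • Γ = Γ} ≤ h * 2 ^ d * 2 ^ k := by
    intro k hk
    refine (Finset.sum_le_card_nsmul _ _ _ hk).trans ?_
    rw [smul_eq_mul]
    exact Nat.mul_le_mul_right _ (hcard T)
  rcases hd.eq_or_lt with rfl | hd2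
  · norm_num at hprod
    refine bound_of_le_two_pow_mul (a := 1) (m := 1) (k := 0) ?_ (by norm_num) (by norm_num)
    refine (hsum 0 fun g hg => ?_).trans (by omega)
    obtain ⟨c, hw, hc⟩ := key g hg
    rw [hw]
    exact Nat.pow_le_pow_right (by norm_num) (by omega)
  obtain ⟨h2, h3, h4⟩ := card_bound_of_finrank_le_ten hd2 hH
  rcases Nat.lt_or_ge d 4 with hd4 | hd4
  · interval_cases d
    · have := h2 rfl
      refine bound_of_le_two_pow_mul (a := 0) (m := 128) (k := 80) ?_ (by norm_num) (by norm_num)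
      refine (hsum 2 (hpow 2 (by norm_num))).trans (by omega)
    · have := h3 rfl
      refine bound_of_le_two_pow_mul (a := 0) (m := 6144) (k := 160) ?_ (by norm_num)
        (by norm_num)
      refine (hsum 4 (hpow 4 (by norm_num))).trans (by omega)
  · have h8 : 2 ^ d = 8 * 2 ^ (d - 3) := by
      rw [← Nat.sub_add_cancel (show 3 ≤ d by omega), pow_add, Nat.add_sub_cancel]
      ring
    refine bound_of_prime_two hd4 (h4 hd4) hsq ?_
    have hP : (T.filter fun g => 4 * Nat.card {x : Ω // g • x = x} = 2 ^ d).card ≤ 4 * h := by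
      have := hcard' (T.filter fun g => 4 * Nat.card {x : Ω // g • x = x} = 2 ^ d)
        (2 * 2 ^ (d - 3)) fun g hg => by
          have := (Finset.mem_filter.1 hg).2
          omega
      have hpos : 0 < 2 * 2 ^ (d - 3) := by positivity
      refine Nat.le_of_mul_le_mul_right (this.trans (le_of_eq ?_)) hpos
      rw [h8]; ring
    refine (sum_le_add_of_forall_le T _ hP (hcard _)
      (fun g hg _ => hpow (4 * 2 ^ (d - 3)) (by omega) g hg)
      (b := 2 ^ (3 * 2 ^ (d - 3))) fun g hg hgP => ?_).trans (by rw [mul_comm (2 ^ d) h])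
    obtain ⟨c, hw, hc⟩ := key g hg
    rw [hw]
    exact Nat.pow_le_pow_right (by norm_num) (by omega)

end AffineTwo

/-- Lemma 2.1(1): for a primitive solvable permutation group `(G, Ω)`, the number of pairs
`(g, Γ)` with `g ∈ G` of odd prime order stabilizing `Γ ⊆ Ω` is at most
`24 ^ (-1/3) * 2 ^ (5|Ω|/9) * |Ω| ^ (13/4)`. -/
theorem stmt_3 {Ω : Type*} [Fintype Ω] (G : Subgroup (Equiv.Perm Ω))
    (hsolv : IsSolvable G) (hprim : IsPrimitivePermGroup Ω G)
    (S : Set (G × Set Ω))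
    (hS : S = {x : G × Set Ω |
      (∃ p : ℕ, p.Prime ∧ p ≠ 2 ∧ orderOf x.1 = p) ∧ x.1 • x.2 = x.2}) :
    (S.ncard : ℝ) ≤ (24 : ℝ) ^ (-(1 / 3 : ℝ)) *
      2 ^ (5 * (Fintype.card Ω : ℝ) / 9) * (Fintype.card Ω : ℝ) ^ ((13 : ℝ) / 4) := by
  classical
  rcases subsingleton_or_nontrivial Ω with hsub | hnt
  · have hS0 : S = ∅ := by
      rw [hS, Set.eq_empty_iff_forall_notMem]
      rintro ⟨g, Γ⟩ ⟨⟨p, hp, -, hg⟩, -⟩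
      rw [Subsingleton.elim g 1, orderOf_one] at hg
      exact hp.one_lt.ne hg
    rw [hS0, Set.ncard_empty, Nat.cast_zero]
    positivity
  have hpre : MulAction.IsPreprimitive G Ω :=
    { exists_smul_eq := hprim.1.exists_smul_eq
      isTrivialBlock_of_isBlock := fun {B} hB => hprim.2 B hB }
  obtain ⟨q, hq, V, _, _, _, e, ρ, hρ, hirr⟩ := exists_affine_coordinates G hsolv hpre
  have hn : Fintype.card Ω = q ^ Module.finrank (ZMod q) V := by
    rw [← Nat.card_eq_fintype_card, ← Nat.card_congr e,
      Module.natCard_eq_pow_finrank (K := ZMod q), Nat.card_zmod]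
  have hd : 1 ≤ Module.finrank (ZMod q) V := by
    by_contra h0
    have := Fintype.one_lt_card (α := Ω)
    rw [hn, show Module.finrank (ZMod q) V = 0 by omega] at this
    simp at this
  let T : Finset G := Finset.univ.filter fun g => ∃ p : ℕ, p.Prime ∧ p ≠ 2 ∧ orderOf g = p
  have hT : ∀ g ∈ T, ∃ p : ℕ, p.Prime ∧ p ≠ 2 ∧ orderOf g = p :=
    fun g hg => (Finset.mem_filter.1 hg).2
  have hsum : S.ncard = ∑ g ∈ T, Nat.card {Γ : Set Ω // g • Γ = Γ} := by
    rw [← ncard_pairs_eq_sum, hS]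
    simp [T]
  refine le_rpow_bound_of_pow_le ?_
  rw [hsum, hn]
  have hq2 := hq.out.two_le
  rcases Nat.lt_or_ge q 5 with hq5 | hq5
  · interval_cases q
    · exact sum_card_invariant_sets_bound_of_prime_two e ρ hρ hsolv hirr hd T hT
    · exact sum_card_invariant_sets_bound_of_prime_three e ρ hρ hd T hT
    · exact absurd hq.out (by norm_num)
  · exact sum_card_invariant_sets_bound_of_five_le e ρ hρ hq5 hd T hT
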